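/- arXiv:2412.12319 — 3 statements merged into one kernel-verified Lean document; each statement's English description precedes it below -/
import Mathlib

section
/- Let S(n) := Σ_{j=1}^{n-1} (-1)^{j-1} C(n-1, j) / h_j and S₂(n) := Σ_{j=1}^{n-1} (-1)^{j-1} C(n-1, j) · 2/h_j², where h_j = Σ_{i=1}^j 1/i. Then there is a constant C such that for all n ≥ 2, |S₂(n) - S(n)² - (2ζ(3)/ζ(2)³)·h_{n-1} - 5ζ(3)²/ζ(2)⁴ + 18/(5π²)| ≤ C · (log n)/n, where ζ(2) = π²/6 and ζ(3) = Σ_{k≥1} k^{-3}. In particular S₂(n) - S(n)² = (2ζ(3)/ζ(2)³)·log n + (2ζ(3)/ζ(2)³)·γ + 5ζ(3)²/ζ(2)⁴ − 18/(5π²) + O((log n)/n), with γ the Euler–Mascheroni constant. -/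
/-- The `m`-th harmonic number `h_m = ∑_{i=1}^m 1/i`, with `h_0 = 0`. -/
noncomputable def harm (m : ℕ) : ℝ := ∑ i ∈ Finset.range m, (1 : ℝ) / (i + 1)

/-- `S(n) = Σ_{j=1}^{n-1} (-1)^{j-1} C(n-1, j) / h_j` (equal to `E[D_n]` in the paper). -/
noncomputable def S (n : ℕ) : ℝ :=
  ∑ j ∈ Finset.Icc 1 (n - 1), (-1 : ℝ) ^ (j - 1) * ((n - 1).choose j) / harm j

/-- `S₂(n) = Σ_{j=1}^{n-1} (-1)^{j-1} C(n-1, j) · 2/h_j²` (equal to `E[D_n²]` in the paper). -/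
noncomputable def S₂ (n : ℕ) : ℝ :=
  ∑ j ∈ Finset.Icc 1 (n - 1), (-1 : ℝ) ^ (j - 1) * ((n - 1).choose j) * (2 / harm j ^ 2)

/-- `ζ(3) = Σ_{k≥1} k⁻³`. -/
noncomputable def zeta3 : ℝ := ∑' k : ℕ, (1 : ℝ) / ((k : ℝ) + 1) ^ 3

namespace Aux
open Finset

/-- truncated harmonic function -/
noncomputable def hK (K : ℕ) (s : ℝ) : ℝ :=
  ∑ k ∈ range K, (1 / ((k : ℝ) + 1) - 1 / ((k : ℝ) + 1 + s))

/-- alternating binomial difference -/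
noncomputable def Del (N : ℕ) (f : ℕ → ℝ) : ℝ :=
  ∑ j ∈ range (N + 1), (-1 : ℝ) ^ j * (N.choose j) * f j

lemma Del_add (N : ℕ) (f g : ℕ → ℝ) : Del N (fun j => f j + g j) = Del N f + Del N g := by
  simp only [Del, mul_add, sum_add_distrib]

lemma Del_mul (N : ℕ) (c : ℝ) (f : ℕ → ℝ) : Del N (fun j => c * f j) = c * Del N f := by
  simp only [Del, mul_sum]
  exact sum_congr rfl fun _ _ => by ring

lemma Del_sum {ι : Type*} (N : ℕ) (s : Finset ι) (f : ι → ℕ → ℝ) :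
    Del N (fun j => ∑ i ∈ s, f i j) = ∑ i ∈ s, Del N (f i) := by
  simp only [Del, mul_sum]
  exact sum_comm

lemma Del_congr (N : ℕ) {f g : ℕ → ℝ} (h : ∀ j, f j = g j) : Del N f = Del N g := by
  simp only [Del, h]

lemma Del_zero_ind (N : ℕ) : Del N (fun j => if j = 0 then 1 else 0) = 1 := by
  simp [Del]

lemma Del_const (N : ℕ) (c : ℝ) : Del (N + 1) (fun _ => c) = 0 := by
  have h := Int.alternating_sum_range_choose_of_ne (n := N + 1) (by omega)
  have h2 : (∑ m ∈ range (N + 1 + 1), (-1 : ℝ) ^ m * ((N + 1).choose m : ℝ)) = 0 := by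
    exact_mod_cast h
  simp only [Del, ← sum_mul, h2, zero_mul]

lemma Del_rec (N : ℕ) (f : ℕ → ℝ) :
    Del (N + 1) (fun j => (j : ℝ) * f j) = (N + 1) * Del (N + 1) f - (N + 1) * Del N f := by
  have e : Del N f = ∑ j ∈ range (N + 1 + 1), (-1 : ℝ) ^ j * (N.choose j) * f j := by
    rw [sum_range_succ, Nat.choose_succ_self]; simp [Del]
  rw [e]
  simp only [Del, mul_sum, ← sum_sub_distrib]
  refine sum_congr rfl fun j _ => ?_
  have : (j : ℝ) * ((N + 1).choose j) = (N + 1) * ((N + 1).choose j) - (N + 1) * (N.choose j) := by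
    rcases j with _ | j
    · simp
    · have h1 := Nat.add_one_mul_choose_eq N j
      have h1' : ((N : ℝ) + 1) * (N.choose j) = ((N + 1).choose (j + 1)) * ((j : ℝ) + 1) := by
        exact_mod_cast h1
      rw [Nat.choose_succ_succ] at *
      push_cast at *
      linarith
  linear_combination (-1 : ℝ) ^ j * f j * this

lemma Del_shift (N : ℕ) (f : ℕ → ℝ) (ρ : ℝ) :
    Del (N + 1) (fun j => ((j : ℝ) + ρ) * f j)
      = (N + 1 + ρ) * Del (N + 1) f - (N + 1) * Del N f := by
  rw [Del_congr (g := fun j => (j : ℝ) * f j + ρ * f j) _ (fun j => by ring), Del_add, Del_mul,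
    Del_rec]
  ring

lemma Del_y (ρ : ℝ) (hρ : 1 ≤ ρ) (N : ℕ) :
    0 ≤ Del N (fun j => 1 / ((j : ℝ) + ρ)) ∧
      Del N (fun j => 1 / ((j : ℝ) + ρ)) ≤ 1 / (ρ * (N + 1)) := by
  induction N with
  | zero => simp [Del]; positivity
  | succ N ih =>
    have h := Del_shift N (fun j => 1 / ((j : ℝ) + ρ)) ρ
    rw [Del_congr (g := fun _ => 1) _ (fun j => by
      have : (j : ℝ) + ρ ≠ 0 := by positivity
      field_simp), Del_const] at h
    obtain ⟨h1, h2⟩ := ih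
    set y := Del (N + 1) (fun j => 1 / ((j : ℝ) + ρ))
    set x := Del N (fun j => 1 / ((j : ℝ) + ρ))
    have hy : y = (N + 1) / (N + 1 + ρ) * x := by
      field_simp; linarith
    rw [hy]
    refine ⟨by positivity, ?_⟩
    calc ((N : ℝ) + 1) / (N + 1 + ρ) * x ≤ ((N : ℝ) + 1) / (N + 1 + 1) * (1 / (ρ * (N + 1))) := by
          gcongr
      _ = _ := by push_cast; field_simp

lemma harm_succ (N : ℕ) : harm (N + 1) = harm N + 1 / ((N : ℝ) + 1) := by
  simp [harm, sum_range_succ]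

lemma harm_nonneg (N : ℕ) : 0 ≤ harm N := sum_nonneg fun _ _ => by positivity

lemma one_le_harm (N : ℕ) : 1 ≤ harm (N + 1) := by
  induction N with
  | zero => simp [harm]
  | succ N ih =>
    rw [harm_succ]
    have : (0 : ℝ) ≤ 1 / (((N + 1 : ℕ) : ℝ) + 1) := by positivity
    linarith

lemma Del_x (ρ σ : ℝ) (hρ : 1 ≤ ρ) (hσ : 1 ≤ σ) (N : ℕ) :
    0 ≤ Del N (fun j => 1 / (((j : ℝ) + ρ) * ((j : ℝ) + σ))) ∧
      Del N (fun j => 1 / (((j : ℝ) + ρ) * ((j : ℝ) + σ))) ≤ harm (N + 1) / (ρ * σ * (N + 1)) := by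
  induction N with
  | zero => simp [Del, harm]; positivity
  | succ N ih =>
    have h := Del_shift N (fun j => 1 / (((j : ℝ) + ρ) * ((j : ℝ) + σ))) ρ
    rw [Del_congr (g := fun j => 1 / ((j : ℝ) + σ)) _ (fun j => by
      have : (j : ℝ) + ρ ≠ 0 := by positivity
      have : (j : ℝ) + σ ≠ 0 := by positivity
      field_simp)] at h
    obtain ⟨h1, h2⟩ := ih
    obtain ⟨g1, g2⟩ := Del_y σ hσ (N + 1)
    set y := Del (N + 1) (fun j => 1 / ((j : ℝ) + σ))
    set z := Del (N + 1) (fun j => 1 / (((j : ℝ) + ρ) * ((j : ℝ) + σ)))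
    set x := Del N (fun j => 1 / (((j : ℝ) + ρ) * ((j : ℝ) + σ)))
    have hz : z = (((N : ℝ) + 1) * x + y) / (N + 1 + ρ) := by
      field_simp; linarith
    rw [hz]
    refine ⟨by positivity, ?_⟩
    rw [harm_succ (N + 1)]
    have hh := one_le_harm N
    set H := harm (N + 1)
    calc (((N : ℝ) + 1) * x + y) / (N + 1 + ρ)
        ≤ (((N : ℝ) + 1) * (H / (ρ * σ * (N + 1))) + 1 / (σ * ((N + 1 : ℕ) + 1))) / (N + 1 + ρ) := by
          gcongr
      _ = (H * (N + 2) + ρ) / (N + 1 + ρ) * (1 / (ρ * σ * (N + 2))) := by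
          push_cast; field_simp; ring
      _ ≤ (H + 1 / (N + 2)) * (1 / (ρ * σ * (N + 2))) := by
          gcongr
          rw [div_le_iff₀ (by positivity)]
          have : (H + 1 / ((N : ℝ) + 2)) * (N + 1 + ρ) - (H * (N + 2) + ρ)
              = (ρ - 1) * (H - (1 - 1 / ((N : ℝ) + 2))) := by
            field_simp; ring
          have h0 : (0 : ℝ) ≤ 1 / ((N : ℝ) + 2) := by positivity
          have : 0 ≤ (ρ - 1) * (H - (1 - 1 / ((N : ℝ) + 2))) :=
            mul_nonneg (by linarith) (by linarith)
          linarith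
      _ = _ := by push_cast; field_simp; ring

/-- second-order harmonic numbers and friends -/
noncomputable def Z (p K : ℕ) : ℝ := ∑ k ∈ range K, 1 / ((k : ℝ) + 1) ^ p

lemma Del_inv (N : ℕ) : Del N (fun j => 1 / (j : ℝ)) = - harm N := by
  induction N with
  | zero => simp [Del, harm]
  | succ N ih =>
    have h := Del_rec N (fun j => 1 / (j : ℝ))
    rw [Del_congr (g := fun j => 1 + (-1) * (if j = 0 then 1 else 0)) _ (fun j => by
      rcases j with _ | j
      · simp
      · push_cast
        have : (j : ℝ) + 1 ≠ 0 := by positivity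
        simp [this]), Del_add, Del_mul, Del_zero_ind, Del_const, ih] at h
    rw [harm_succ]
    have : (N : ℝ) + 1 ≠ 0 := by positivity
    field_simp
    linarith

lemma Del_inv_sq (N : ℕ) : Del N (fun j => 1 / (j : ℝ) ^ 2) = - (harm N ^ 2 + Z 2 N) / 2 := by
  induction N with
  | zero => simp [Del, harm, Z]
  | succ N ih =>
    have h := Del_rec N (fun j => 1 / (j : ℝ) ^ 2)
    rw [Del_congr (g := fun j => 1 / (j : ℝ)) _ (fun j => by
      rcases j with _ | j
      · simp
      · push_cast
        have : (j : ℝ) + 1 ≠ 0 := by positivity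
        field_simp), Del_inv, ih] at h
    have e : Z 2 (N + 1) = Z 2 N + 1 / ((N : ℝ) + 1) ^ 2 := by simp [Z, sum_range_succ]
    rw [e]
    rw [harm_succ] at *
    have : (N : ℝ) + 1 ≠ 0 := by positivity
    set D := Del (N + 1) (fun j => 1 / (j : ℝ) ^ 2)
    have : D = -(harm N + 1 / ((N : ℝ) + 1)) / (N + 1) + -(harm N ^ 2 + Z 2 N) / 2 := by
      rw [h]; field_simp; ring
    rw [this]; field_simp; ring

open Polynomial in
lemma root_exists (K m : ℕ) (hm : m + 1 < K) :
    ∃ x : ℝ, -((m : ℝ) + 2) < x ∧ x < -((m : ℝ) + 1) ∧ hK K x = 0 := by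
  classical
  set T := ((range K).erase m).erase (m + 1) with hT
  let q : ℝ → ℝ := fun s => (s + m + 1) * (s + m + 2) *
      (∑ k ∈ T, (1 / ((k : ℝ) + 1) - 1 / ((k : ℝ) + 1 + s)) + (1 / ((m : ℝ) + 1) + 1 / ((m : ℝ) + 2)))
      - (s + m + 2) - (s + m + 1)
  have hne : ∀ s ∈ Set.Icc (-((m : ℝ) + 2)) (-((m : ℝ) + 1)), ∀ k ∈ T, (k : ℝ) + 1 + s ≠ 0 := by
    intro s hs k hk h
    simp only [hT, mem_erase, mem_range] at hk
    obtain ⟨h1, h2, -⟩ := hk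
    obtain ⟨h3, h4⟩ := hs
    have h5 : (m : ℝ) ≤ k := by linarith
    have h6 : (k : ℝ) ≤ (m + 1 : ℕ) := by push_cast; linarith
    have h5' : m ≤ k := by exact_mod_cast h5
    have h6' : k ≤ m + 1 := by exact_mod_cast h6
    omega
  have hc : ContinuousOn q (Set.Icc (-((m : ℝ) + 2)) (-((m : ℝ) + 1))) := by
    have : ContinuousOn (fun s : ℝ => ∑ k ∈ T, (1 / ((k : ℝ) + 1) - 1 / ((k : ℝ) + 1 + s)))
        (Set.Icc (-((m : ℝ) + 2)) (-((m : ℝ) + 1))) := by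
      refine continuousOn_finsetSum _ fun k hk => ?_
      refine ContinuousOn.sub continuousOn_const (ContinuousOn.div continuousOn_const
        (by fun_prop) fun s hs => hne s hs k hk)
    simp only [q]
    fun_prop
  have hq1 : q (-((m : ℝ) + 2)) = 1 := by simp only [q]; ring_nf
  have hq2 : q (-((m : ℝ) + 1)) = -1 := by simp only [q]; ring_nf
  have := intermediate_value_Icc' (by linarith) hc
  obtain ⟨x, hx, hx0⟩ := this (show (0 : ℝ) ∈ Set.Icc _ _ by rw [hq1, hq2]; constructor <;> norm_num)
  have n1 : x ≠ -((m : ℝ) + 2) := by rintro rfl; rw [hq1] at hx0; norm_num at hx0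
  have n2 : x ≠ -((m : ℝ) + 1) := by rintro rfl; rw [hq2] at hx0; norm_num at hx0
  refine ⟨x, lt_of_le_of_ne hx.1 n1.symm, lt_of_le_of_ne hx.2 n2, ?_⟩
  have d1 : x + m + 2 ≠ 0 := fun h => n1 (by linarith)
  have d2 : x + m + 1 ≠ 0 := fun h => n2 (by linarith)
  have e : hK K x = ∑ k ∈ T, (1 / ((k : ℝ) + 1) - 1 / ((k : ℝ) + 1 + x))
      + (1 / ((m : ℝ) + 1) - 1 / (x + m + 1)) + (1 / ((m : ℝ) + 2) - 1 / (x + m + 2)) := by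
    rw [hK, ← add_sum_erase (range K) _ (mem_range.2 (show m < K by omega)),
      ← add_sum_erase ((range K).erase m) _ (a := m + 1) (by simp; omega)]
    push_cast
    rw [show (m : ℝ) + 1 + 1 + x = x + m + 2 by ring, show (m : ℝ) + 1 + x = x + m + 1 by ring,
      show (m : ℝ) + 1 + 1 = m + 2 by ring]
    ring
  have : (x + m + 1) * (x + m + 2) * hK K x = 0 := by
    rw [← hx0, e]; simp only [q]
    generalize ∑ k ∈ T, (1 / ((k : ℝ) + 1) - 1 / ((k : ℝ) + 1 + x)) = W
    field_simp
    ring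
  simpa [d1, d2] using this

lemma hK_sub (K : ℕ) (x s : ℝ) (hx : ∀ k : ℕ, (k : ℝ) + 1 + x ≠ 0) (hs : ∀ k : ℕ, (k : ℝ) + 1 + s ≠ 0)
    (h0 : hK K x = 0) :
    hK K s = (s - x) * ∑ k ∈ range K, 1 / (((k : ℝ) + 1 + s) * ((k : ℝ) + 1 + x)) := by
  have : hK K s = hK K s - hK K x := by rw [h0, sub_zero]
  rw [this, hK, hK, ← sum_sub_distrib, mul_sum]
  refine sum_congr rfl fun k _ => ?_
  have h1 := hx k
  have h2 := hs k
  field_simp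
  ring

open Polynomial Lagrange in
lemma partial_frac (K : ℕ) (hK0 : 0 < K) (x : ℕ → ℝ) (hinj : Set.InjOn x (range K : Set ℕ))
    (hx : ∀ i, ∀ k : ℕ, (k : ℝ) + 1 + x i ≠ 0) (h0 : ∀ i ∈ range K, hK K (x i) = 0) :
    ∃ (a : ℝ) (c : ℕ → ℝ), 0 < a ∧ ∀ s : ℝ, (∀ k : ℕ, (k : ℝ) + 1 + s ≠ 0) →
      (∀ i ∈ range K, s ≠ x i) → hK K s * (a + ∑ i ∈ range K, c i / (s - x i)) = 1 := by
  classical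
  set v : ℕ → ℝ := fun k => -((k : ℝ) + 1) with hv
  set P : ℝ[X] := nodal (range K) v with hP
  set W : ℝ[X] := nodal (range K) x with hW
  set H : ℝ := harm K with hH
  have Hpos : 0 < H := by
    rw [hH]; obtain ⟨K, rfl⟩ := Nat.exists_eq_succ_of_ne_zero hK0.ne'
    linarith [one_le_harm K]
  set N : ℝ[X] := C H * P - ∑ k ∈ range K, nodal ((range K).erase k) v with hN
  have evN : ∀ s : ℝ, (∀ k : ℕ, (k : ℝ) + 1 + s ≠ 0) → eval s N = eval s P * hK K s := by
    intro s hs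
    simp only [hN, eval_sub, eval_mul, eval_C, hK, sum_sub_distrib, eval_finsetSum, mul_sub]
    have : H = ∑ k ∈ range K, 1 / ((k : ℝ) + 1) := rfl
    rw [← this, mul_comm H, mul_sum]
    congr 1
    refine sum_congr rfl fun k hk => ?_
    rw [hP, nodal_eq_mul_nodal_erase hk]
    simp only [eval_mul, eval_sub, eval_X, eval_C, hv]
    have := hs k
    rw [show s - -((k : ℝ) + 1) = (k : ℝ) + 1 + s by ring]
    field_simp
  have dP : P.degree = K := by rw [hP, degree_nodal, card_range]
  have dW : W.degree = K := by rw [hW, degree_nodal, card_range]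
  have dPW : (P - W).degree < K := by
    rw [← dP]
    exact degree_sub_lt_left (by rw [dP, dW]) nodal_monic.ne_zero
      (by rw [nodal_monic.leadingCoeff, nodal_monic.leadingCoeff])
  have NW : N = C H * W := by
    refine eq_of_degree_sub_lt_of_eval_index_eq (range K) hinj ?_ ?_
    · rw [card_range]
      have : N - C H * W = C H * (P - W) - ∑ k ∈ range K, nodal ((range K).erase k) v := by
        rw [hN]; ring
      rw [this]
      refine lt_of_le_of_lt (degree_sub_le _ _) (max_lt ?_ ?_)
      · rw [degree_C_mul Hpos.ne']; exact dPW
      · refine lt_of_le_of_lt (degree_sum_le _ _) ?_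
        rw [Finset.sup_lt_iff (WithBot.bot_lt_coe _)]
        intro k hk
        rw [degree_nodal, card_erase_of_mem hk, card_range]
        exact_mod_cast Nat.sub_lt hK0 one_pos
    · intro i hi
      rw [evN _ (hx i), h0 i hi, eval_mul, hW, eval_nodal_at_node hi]
      simp
  have interp : P - W = interpolate (range K) x (fun i => eval (x i) P) := by
    refine eq_interpolate_of_eval_eq _ hinj (by rwa [card_range]) fun i hi => ?_
    rw [eval_sub, hW, eval_nodal_at_node hi, sub_zero]
  refine ⟨1 / H, fun i => nodalWeight (range K) x i * eval (x i) P / H, by positivity, ?_⟩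
  intro s hs hsx
  have e1 : eval s P - eval s W = eval s W *
      ∑ i ∈ range K, nodalWeight (range K) x i * (s - x i)⁻¹ * eval (x i) P := by
    rw [← eval_sub, interp, eval_interpolate_not_at_node _ hsx]
  have e2 : H * eval s W = eval s P * hK K s := by
    rw [← evN s hs, NW, eval_mul, eval_C]
  have hWne : eval s W ≠ 0 := by
    rw [hW, eval_nodal, prod_ne_zero_iff]
    intro i hi; exact sub_ne_zero.2 (hsx i hi)
  have hPne : eval s P ≠ 0 := by
    rw [hP, eval_nodal, prod_ne_zero_iff]
    intro i hi h; exact hs i (by simp only [hv] at h; linarith)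
  have e3 : 1 / H + ∑ i ∈ range K, nodalWeight (range K) x i * eval (x i) P / H / (s - x i)
      = eval s P / (H * eval s W) := by
    have : ∑ i ∈ range K, nodalWeight (range K) x i * eval (x i) P / H / (s - x i)
        = (∑ i ∈ range K, nodalWeight (range K) x i * (s - x i)⁻¹ * eval (x i) P) / H := by
      rw [sum_div]; exact sum_congr rfl fun i _ => by ring
    rw [this]
    generalize ∑ i ∈ range K, nodalWeight (range K) x i * (s - x i)⁻¹ * eval (x i) P = V at *
    field_simp
    linarith
  rw [e3, e2]
  have : hK K s ≠ 0 := by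
    intro h; rw [h, mul_zero] at e2
    exact (mul_ne_zero Hpos.ne' hWne) e2
  field_simp

open Filter Topology in
lemma coef_pos (K : ℕ) (x : ℕ → ℝ) (hinj : Set.InjOn x (range K : Set ℕ))
    (hx : ∀ i, ∀ k : ℕ, (k : ℝ) + 1 + x i ≠ 0) (h0 : ∀ i ∈ range K, hK K (x i) = 0)
    (a : ℝ) (c : ℕ → ℝ) (i : ℕ) (hi : i ∈ range K)
    (hev : ∀ᶠ s in 𝓝 (x i), ∀ k : ℕ, (k : ℝ) + 1 + s ≠ 0)
    (h : ∀ s : ℝ, (∀ k : ℕ, (k : ℝ) + 1 + s ≠ 0) →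
      (∀ i ∈ range K, s ≠ x i) → hK K s * (a + ∑ i ∈ range K, c i / (s - x i)) = 1) :
    0 < c i := by
  classical
  let T : ℝ → ℝ := fun s => ∑ k ∈ range K, 1 / (((k : ℝ) + 1 + s) * ((k : ℝ) + 1 + x i))
  let G : ℝ → ℝ := fun s => T s * (c i + (s - x i) * (a + ∑ j ∈ (range K).erase i, c j / (s - x j)))
  have hne : ∀ j ∈ (range K).erase i, x i ≠ x j := by
    intro j hj hij
    obtain ⟨h1, h2⟩ := mem_erase.1 hj
    exact h1 (hinj (by simpa using h2) (by simpa using hi) hij.symm)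
  have hG : ContinuousAt G (x i) := by
    have t1 : ContinuousAt T (x i) := by
      refine tendsto_finsetSum _ fun k _ => ?_
      refine ContinuousAt.div continuousAt_const (by fun_prop) (mul_ne_zero (hx i k) (hx i k))
    have t2 : ContinuousAt (fun s => ∑ j ∈ (range K).erase i, c j / (s - x j)) (x i) := by
      refine tendsto_finsetSum _ fun j hj => ?_
      exact ContinuousAt.div continuousAt_const (by fun_prop) (sub_ne_zero.2 (hne j hj))
    simp only [G]
    fun_prop
  have hev2 : ∀ᶠ s in 𝓝[≠] (x i), G s = 1 := by
    have e1 : ∀ᶠ s in 𝓝 (x i), ∀ j ∈ (range K).erase i, s ≠ x j :=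
      (eventually_all_finset _).2 fun j hj => isOpen_ne.mem_nhds (hne j hj)
    filter_upwards [nhdsWithin_le_nhds hev, nhdsWithin_le_nhds e1, self_mem_nhdsWithin]
      with s h1 h2 h3
    have h3' : s ≠ x i := h3
    have := h s h1 (fun j hj => by
      by_cases hji : j = i
      · rw [hji]; exact h3'
      · exact h2 j (mem_erase.2 ⟨hji, hj⟩))
    rw [hK_sub K (x i) s (hx i) h1 (h0 i hi), ← add_sum_erase (range K) (fun j => c j / (s - x j)) hi] at this
    rw [← this]
    simp only [G, T]
    have h4 := sub_ne_zero.2 h3'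
    generalize ∑ k ∈ range K, 1 / (((k : ℝ) + 1 + s) * ((k : ℝ) + 1 + x i)) = V
    generalize ∑ j ∈ (range K).erase i, c j / (s - x j) = V'
    field_simp
    ring
  have lim : G (x i) = 1 :=
    tendsto_nhds_unique (hG.tendsto.mono_left nhdsWithin_le_nhds)
      ((tendsto_congr' hev2).2 tendsto_const_nhds)
  simp only [G, sub_self, zero_mul, add_zero] at lim
  have Tpos : 0 < T (x i) := by
    refine sum_pos (fun k _ => ?_) ⟨i, hi⟩
    exact one_div_pos.2 (mul_self_pos.2 (hx i k))
  by_contra hc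
  have := mul_nonpos_of_nonneg_of_nonpos Tpos.le (not_lt.1 hc)
  linarith

open Filter Topology in
lemma decomp (K : ℕ) : ∃ (a b : ℝ) (c ρ : ℕ → ℝ), 0 < a ∧ 0 < b ∧ (∀ i, 0 ≤ c i) ∧ (∀ i, 1 ≤ ρ i) ∧
    ∀ s : ℝ, 0 < s → hK (K + 1) s * (a + b / s + ∑ i ∈ range K, c i / (s + ρ i)) = 1 := by
  classical
  have hr : ∀ m : ℕ, ∃ x : ℝ, -((m : ℝ) + 2) < x ∧ x < -((m : ℝ) + 1) ∧
      (m < K → hK (K + 1) x = 0) := by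
    intro m
    by_cases hm : m < K
    · obtain ⟨x, h1, h2, h3⟩ := root_exists (K + 1) m (by omega)
      exact ⟨x, h1, h2, fun _ => h3⟩
    · exact ⟨-((m : ℝ) + 3 / 2), by linarith, by linarith, fun h => absurd h hm⟩
  choose y hy1 hy2 hy3 using hr
  let x : ℕ → ℝ := fun i => if i = 0 then 0 else y (i - 1)
  have xs : ∀ i, x (i + 1) = y i := fun i => by simp [x]
  have x0 : x 0 = 0 := by simp [x]
  have ylt : ∀ i j, i < j → y j < y i := by
    intro i j hij
    have : (i : ℝ) + 1 ≤ j := by exact_mod_cast hij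
    linarith [hy1 i, hy2 j]
  have yinj : Function.Injective y := by
    intro i j hij
    rcases lt_trichotomy i j with h | h | h
    · exact absurd hij (ylt i j h).ne'
    · exact h
    · exact absurd hij (ylt j i h).ne
  have yneg : ∀ i, y i < -1 := fun i => by
    have : (0 : ℝ) ≤ i := by positivity
    linarith [hy2 i]
  have xinj : Function.Injective x := by
    intro i j hij
    rcases i with _ | i <;> rcases j with _ | j
    · rfl
    · rw [x0, xs] at hij; linarith [yneg j]
    · rw [x0, xs] at hij; linarith [yneg i]
    · rw [xs, xs] at hij; rw [yinj hij]
  -- neighbourhoods free of negative integers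
  have ynon : ∀ m : ℕ, ∀ s, -((m : ℝ) + 2) < s → s < -((m : ℝ) + 1) → ∀ k : ℕ, (k : ℝ) + 1 + s ≠ 0 := by
    intro m s h1 h2 k hk
    have h3 : (m : ℝ) < k := by linarith
    have h4 : (k : ℝ) < (m + 1 : ℕ) := by push_cast; linarith
    have h3' : m < k := by exact_mod_cast h3
    have h4' : k < m + 1 := by exact_mod_cast h4
    omega
  have hev : ∀ i, ∀ᶠ s in 𝓝 (x i), ∀ k : ℕ, (k : ℝ) + 1 + s ≠ 0 := by
    intro i
    rcases i with _ | i
    · rw [x0]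
      filter_upwards [lt_mem_nhds (show (-1 : ℝ) < 0 by norm_num)] with s hs k hk
      have : (0 : ℝ) ≤ k := by positivity
      linarith
    · rw [xs]
      filter_upwards [lt_mem_nhds (hy1 i), gt_mem_nhds (hy2 i)] with s h1 h2
      exact ynon i s h1 h2
  have hx : ∀ i, ∀ k : ℕ, (k : ℝ) + 1 + x i ≠ 0 := fun i => (hev i).self_of_nhds
  have h0 : ∀ i ∈ range (K + 1), hK (K + 1) (x i) = 0 := by
    intro i hi
    rcases i with _ | i
    · rw [x0]; simp [hK]
    · rw [xs]; exact hy3 i (by simpa using hi)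
  obtain ⟨a, c, ha, hac⟩ := partial_frac (K + 1) (by omega) x xinj.injOn hx h0
  have cpos : ∀ i ∈ range (K + 1), 0 < c i := fun i hi =>
    coef_pos (K + 1) x xinj.injOn hx h0 a c i hi (hev i) hac
  refine ⟨a, c 0, fun i => if i < K then c (i + 1) else 0, fun i => - y i, ha,
    cpos 0 (by simp), ?_, fun i => by linarith [yneg i], ?_⟩
  · intro i
    by_cases h : i < K
    · simp only [h, if_true]; exact (cpos _ (by simpa using h)).le
    · simp [h]
  · intro s hs
    have := hac s (fun k => by positivity) (fun i _ => by
      rcases i with _ | i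
      · rw [x0]; exact hs.ne'
      · rw [xs]; linarith [yneg i])
    rw [sum_range_succ', x0, sub_zero] at this
    rw [← this]
    congr 1
    rw [add_assoc, add_comm (c 0 / s)]
    congr 2
    refine sum_congr rfl fun i hi => ?_
    simp only [xs, if_pos (mem_range.1 hi), sub_eq_add_neg]

/-- auxiliary Stieltjes sums -/
noncomputable def Fp (p K : ℕ) (s : ℝ) : ℝ := ∑ k ∈ range K, 1 / (((k : ℝ) + 1) ^ p * ((k : ℝ) + 1 + s))

lemma Fp_zero (p K : ℕ) : Fp p K 0 = Z (p + 1) K := by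
  refine sum_congr rfl fun k _ => ?_
  rw [add_zero, pow_succ]

lemma Fp_eq (p K : ℕ) (s : ℝ) (hs : 0 < s) : Fp p K s = Z (p + 1) K - s * Fp (p + 1) K s := by
  rw [Fp, Z, Fp, mul_sum, ← sum_sub_distrib]
  refine sum_congr rfl fun k _ => ?_
  field_simp
  ring

lemma hK_eq (K : ℕ) (s : ℝ) (hs : 0 < s) : hK K s = s * Fp 1 K s := by
  rw [hK, Fp, mul_sum]
  refine sum_congr rfl fun k _ => ?_
  field_simp
  ring

lemma Fp_cont (p K : ℕ) : ContinuousAt (Fp p K) 0 := by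
  refine tendsto_finsetSum _ fun k _ => ?_
  refine ContinuousAt.div continuousAt_const (by fun_prop) (by positivity)

lemma R_cont (K : ℕ) (c ρ : ℕ → ℝ) (hρ : ∀ i, 1 ≤ ρ i) :
    ContinuousAt (fun s : ℝ => ∑ i ∈ range K, c i / (s + ρ i)) 0 := by
  refine tendsto_finsetSum _ fun i _ => ?_
  exact ContinuousAt.div continuousAt_const (by fun_prop) (by linarith [hρ i])

open Filter Topology in
lemma lim0 (f g : ℝ → ℝ) (hf : ContinuousAt f 0) (hg : ContinuousAt g 0)
    (h : ∀ s, 0 < s → f s = g s) : f 0 = g 0 := by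
  have h1 : Tendsto f (𝓝[>] 0) (𝓝 (f 0)) := hf.tendsto.mono_left nhdsWithin_le_nhds
  have h2 : Tendsto g (𝓝[>] 0) (𝓝 (g 0)) := hg.tendsto.mono_left nhdsWithin_le_nhds
  refine tendsto_nhds_unique h1 (h2.congr' ?_)
  filter_upwards [self_mem_nhdsWithin] with s hs
  exact (h s hs).symm

lemma coefs (K L : ℕ) (a b : ℝ) (c ρ : ℕ → ℝ) (hρ : ∀ i, 1 ≤ ρ i)
    (h : ∀ s : ℝ, 0 < s → hK K s * (a + b / s + ∑ i ∈ range L, c i / (s + ρ i)) = 1) :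
    Z 2 K * b = 1 ∧ Z 2 K * (a + ∑ i ∈ range L, c i / ρ i) = b * Z 3 K ∧
    Z 3 K * (a + ∑ i ∈ range L, c i / ρ i) + Z 2 K * (∑ i ∈ range L, c i / ρ i ^ 2) = b * Z 4 K := by
  set r := a + ∑ i ∈ range L, c i / ρ i with hr
  have cF := fun p => Fp_cont p K
  have cR := R_cont L c ρ hρ
  have cE := R_cont L (fun i => c i / ρ i) ρ hρ
  have h1 : ∀ s : ℝ, 0 < s → Fp 1 K s * (b + s * (a + ∑ i ∈ range L, c i / (s + ρ i))) = 1 := by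
    intro s hs
    rw [← h s hs, hK_eq K s hs]
    generalize ∑ i ∈ range L, c i / (s + ρ i) = V
    field_simp
    ring
  have A1 : Z 2 K * b = 1 := by
    have := lim0 (fun s => Fp 1 K s * (b + s * (a + ∑ i ∈ range L, c i / (s + ρ i)))) (fun _ => 1)
      (by have := cF 1; fun_prop) (by fun_prop) h1
    simpa [Fp_zero] using this
  have h2 : ∀ s : ℝ, 0 < s → Fp 1 K s * (a + ∑ i ∈ range L, c i / (s + ρ i)) = b * Fp 2 K s := by
    intro s hs
    have e := h1 s hs
    have e2 := Fp_eq 1 K s hs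
    norm_num at e2
    generalize ∑ i ∈ range L, c i / (s + ρ i) = V at *
    have : s * (Fp 1 K s * (a + V) - b * Fp 2 K s) = 0 := by
      linear_combination e - A1 - b * e2
    rcases mul_eq_zero.1 this with h | h <;> linarith
  have A2 : Z 2 K * r = b * Z 3 K := by
    have := lim0 (fun s => Fp 1 K s * (a + ∑ i ∈ range L, c i / (s + ρ i))) (fun s => b * Fp 2 K s)
      (by have := cF 1; fun_prop) (by have := cF 2; fun_prop) h2
    simpa [Fp_zero] using this
  have h3 : ∀ s : ℝ, 0 < s → Fp 2 K s * r + Fp 1 K s * (∑ i ∈ range L, c i / ρ i / (s + ρ i))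
      = b * Fp 3 K s := by
    intro s hs
    have e := h2 s hs
    have e2 := Fp_eq 1 K s hs
    have e3 := Fp_eq 2 K s hs
    norm_num at e2 e3
    have eR : a + ∑ i ∈ range L, c i / (s + ρ i) = r - s * ∑ i ∈ range L, c i / ρ i / (s + ρ i) := by
      rw [hr, mul_sum, add_sub_assoc, ← sum_sub_distrib]
      congr 1
      refine sum_congr rfl fun i _ => ?_
      have := hρ i
      have : 0 < s + ρ i := by linarith
      field_simp
      ring
    rw [eR] at e
    generalize ∑ i ∈ range L, c i / ρ i / (s + ρ i) = V at *
    have : s * (Fp 2 K s * r + Fp 1 K s * V - b * Fp 3 K s) = 0 := by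
      linear_combination -e + A2 + r * e2 - b * e3
    rcases mul_eq_zero.1 this with h | h <;> linarith
  refine ⟨A1, A2, ?_⟩
  have := lim0 (fun s => Fp 2 K s * r + Fp 1 K s * (∑ i ∈ range L, c i / ρ i / (s + ρ i)))
    (fun s => b * Fp 3 K s)
    (by have := cF 1; have := cF 2; fun_prop) (by have := cF 3; fun_prop) h3
  simpa [Fp_zero, pow_two, div_div] using this

lemma est1 (N L : ℕ) (c ρ : ℕ → ℝ) (hc : ∀ i, 0 ≤ c i) (hρ : ∀ i, 1 ≤ ρ i) :
    0 ≤ Del N (fun j => ∑ i ∈ range L, c i / ((j : ℝ) + ρ i)) ∧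
    Del N (fun j => ∑ i ∈ range L, c i / ((j : ℝ) + ρ i)) ≤ (∑ i ∈ range L, c i / ρ i) / (N + 1) := by
  have : Del N (fun j => ∑ i ∈ range L, c i / ((j : ℝ) + ρ i))
      = ∑ i ∈ range L, c i * Del N (fun j => 1 / ((j : ℝ) + ρ i)) := by
    rw [Del_sum]
    refine sum_congr rfl fun i _ => ?_
    rw [← Del_mul]
    exact Del_congr _ fun j => by ring
  rw [this]
  constructor
  · exact sum_nonneg fun i _ => mul_nonneg (hc i) (Del_y _ (hρ i) N).1
  · rw [sum_div]
    refine sum_le_sum fun i _ => ?_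
    refine (mul_le_mul_of_nonneg_left (Del_y _ (hρ i) N).2 (hc i)).trans (le_of_eq ?_)
    rw [div_div]; ring

lemma est2 (N L : ℕ) (c ρ : ℕ → ℝ) (hc : ∀ i, 0 ≤ c i) (hρ : ∀ i, 1 ≤ ρ i) :
    0 ≤ Del N (fun j => (∑ i ∈ range L, c i / ((j : ℝ) + ρ i)) ^ 2) ∧
    Del N (fun j => (∑ i ∈ range L, c i / ((j : ℝ) + ρ i)) ^ 2)
      ≤ (∑ i ∈ range L, c i / ρ i) ^ 2 * harm (N + 1) / (N + 1) := by
  have : Del N (fun j => (∑ i ∈ range L, c i / ((j : ℝ) + ρ i)) ^ 2)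
      = ∑ i ∈ range L, ∑ k ∈ range L,
        (c i * c k) * Del N (fun j => 1 / (((j : ℝ) + ρ i) * ((j : ℝ) + ρ k))) := by
    rw [Del_congr (g := fun j => ∑ i ∈ range L, ∑ k ∈ range L,
      (c i / ((j : ℝ) + ρ i)) * (c k / ((j : ℝ) + ρ k))) _ (fun j => by rw [sq, sum_mul_sum]), Del_sum]
    refine sum_congr rfl fun i _ => ?_
    rw [Del_sum]
    refine sum_congr rfl fun k _ => ?_
    rw [← Del_mul]
    exact Del_congr _ fun j => by rw [div_mul_div_comm]; ring
  rw [this]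
  constructor
  · exact sum_nonneg fun i _ => sum_nonneg fun k _ =>
      mul_nonneg (mul_nonneg (hc i) (hc k)) (Del_x _ _ (hρ i) (hρ k) N).1
  · rw [sq, sum_mul_sum, mul_div_assoc, sum_mul]
    refine sum_le_sum fun i _ => ?_
    rw [sum_mul]
    refine sum_le_sum fun k _ => ?_
    refine (mul_le_mul_of_nonneg_left (Del_x _ _ (hρ i) (hρ k) N).2
      (mul_nonneg (hc i) (hc k))).trans (le_of_eq ?_)
    have := hρ i
    have := hρ k
    field_simp

lemma levelK (K N : ℕ) : 
    ∃ b r e : ℝ, Z 2 (K + 1) * b = 1 ∧ Z 2 (K + 1) * r = b * Z 3 (K + 1) ∧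
      Z 3 (K + 1) * r + Z 2 (K + 1) * e = b * Z 4 (K + 1) ∧ 
      |- Del (N + 1) (fun j => 1 / hK (K + 1) j) - b * harm (N + 1) - r| ≤ r / (N + 2) ∧
      |- Del (N + 1) (fun j => 1 / hK (K + 1) j ^ 2) - b ^ 2 * (harm (N + 1) ^ 2 + Z 2 (N + 1)) / 2
        - 2 * b * r * harm (N + 1) + 2 * b * e - r ^ 2| ≤
        (2 * b * e + 2 * r ^ 2 + r ^ 2 * harm (N + 2)) / (N + 2) := by
  obtain ⟨a, b, c, ρ, ha, hb, hc, hρ, h⟩ := decomp K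
  obtain ⟨A1, A2, A3⟩ := coefs (K + 1) K a b c ρ hρ h
  set R0 := ∑ i ∈ range K, c i / ρ i with hR0
  set e := ∑ i ∈ range K, c i / ρ i ^ 2 with he
  have R0n : 0 ≤ R0 := sum_nonneg fun i _ => div_nonneg (hc i) (by linarith [hρ i])
  refine ⟨b, a + R0, e, A1, A2, A3, ?_, ?_⟩
  · have hf : ∀ j : ℕ, 1 / hK (K + 1) j = a + (b * (1 / (j : ℝ)) +
        ((∑ i ∈ range K, c i / ((j : ℝ) + ρ i)) + (-(a + R0)) * (if j = 0 then 1 else 0))) := by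
      intro j
      rcases j with _ | j
      · simp [hK, hR0]
      · have := h ((j + 1 : ℕ) : ℝ) (by positivity)
        rw [one_div, ← eq_inv_of_mul_eq_one_right this]
        simp; ring
    obtain ⟨g1, g2⟩ := est1 (N + 1) K c ρ hc hρ
    rw [Del_congr _ hf, Del_add, Del_const, Del_add, Del_mul, Del_inv, Del_add, Del_mul, Del_zero_ind]
    rw [← hR0] at g2
    set D := Del (N + 1) (fun j => ∑ i ∈ range K, c i / ((j : ℝ) + ρ i))
    have : R0 / (((N + 1 : ℕ) : ℝ) + 1) ≤ (a + R0) / (N + 2) := by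
      push_cast; rw [add_assoc (N : ℝ)]; norm_num; gcongr; linarith
    rw [abs_le]
    constructor <;> linarith
  · have hf : ∀ j : ℕ, 1 / hK (K + 1) j ^ 2 = b ^ 2 * (1 / (j : ℝ) ^ 2) + (2 * b * (a + R0) * (1 / (j : ℝ))
        + ((-2 * b) * (∑ i ∈ range K, c i / ρ i / ((j : ℝ) + ρ i)) 
        + (a ^ 2 + (2 * a * (∑ i ∈ range K, c i / ((j : ℝ) + ρ i))
        + ((∑ i ∈ range K, c i / ((j : ℝ) + ρ i)) ^ 2
        + (2 * b * e - (a + R0) ^ 2) * (if j = 0 then 1 else 0)))))) := by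
      intro j
      rcases j with _ | j
      · simp [hK, hR0, he, div_div, sq]
        ring
      · have := h ((j + 1 : ℕ) : ℝ) (by positivity)
        rw [← one_div_pow, one_div, ← eq_inv_of_mul_eq_one_right this]
        have eR : (∑ i ∈ range K, c i / ρ i / (((j + 1 : ℕ) : ℝ) + ρ i)) = 
          (R0 - ∑ i ∈ range K, c i / (((j + 1 : ℕ) : ℝ) + ρ i)) / ((j + 1 : ℕ) : ℝ) := by
          rw [hR0, ← sum_sub_distrib, sum_div]
          refine sum_congr rfl fun i _ => ?_
          have := hρ i
          field_simp
          ring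
        rw [eR, if_neg (by omega)]
        generalize ∑ i ∈ range K, c i / (((j + 1 : ℕ) : ℝ) + ρ i) = V
        field_simp
        ring
    obtain ⟨g1, g2⟩ := est1 (N + 1) K c ρ hc hρ
    obtain ⟨k1, k2⟩ := est1 (N + 1) K (fun i => c i / ρ i) ρ
      (fun i => div_nonneg (hc i) (by linarith [hρ i])) hρ
    obtain ⟨l1, l2⟩ := est2 (N + 1) K c ρ hc hρ
    rw [Del_congr _ hf, Del_add, Del_mul, Del_inv_sq, Del_add, Del_mul, Del_inv, Del_add, Del_mul,
      Del_add, Del_const, Del_add, Del_mul, Del_add, Del_mul, Del_zero_ind]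
    have he' : ∑ i ∈ range K, c i / ρ i / ρ i = e := by simp [he, sq, div_div]
    rw [← hR0] at g2 l2
    rw [he'] at k2
    set D1 := Del (N + 1) (fun j => ∑ i ∈ range K, c i / ((j : ℝ) + ρ i))
    set D2 := Del (N + 1) (fun j => ∑ i ∈ range K, c i / ρ i / ((j : ℝ) + ρ i))
    set D3 := Del (N + 1) (fun j => (∑ i ∈ range K, c i / ((j : ℝ) + ρ i)) ^ 2)
    have eN : ((N + 1 : ℕ) : ℝ) + 1 = N + 2 := by push_cast; ring
    rw [eN] at g2 k2 l2
    have Hn := harm_nonneg (N + 1 + 1)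
    have g3 : 2 * a * D1 ≤ 2 * (a + R0) ^ 2 / (N + 2) := by
      calc 2 * a * D1 ≤ 2 * a * (R0 / (N + 2)) := by gcongr
        _ = 2 * (a * R0) / (N + 2) := by ring
        _ ≤ _ := by gcongr; nlinarith
    have g4 : 0 ≤ 2 * a * D1 := by positivity
    have k3 : 2 * b * D2 ≤ 2 * b * e / (N + 2) := by
      calc 2 * b * D2 ≤ 2 * b * (e / (N + 2)) := by gcongr
        _ = _ := by ring
    have k4 : 0 ≤ 2 * b * D2 := by positivity
    have l3 : D3 ≤ (a + R0) ^ 2 * harm (N + 2) / (N + 2) := by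
      refine l2.trans ?_
      gcongr
      linarith
    have l4 : 0 ≤ 2 * b * e / (N + 2) := k4.trans k3
    have l5 : 0 ≤ 2 * (a + R0) ^ 2 / (N + 2) := g4.trans g3
    have l6 : 0 ≤ (a + R0) ^ 2 * harm (N + 2) / (N + 2) := l1.trans l3
    rw [add_div, add_div, abs_le]
    constructor <;> linarith

open Filter Topology

lemma hK_nat (K j : ℕ) : hK K j = harm j - ∑ i ∈ range j, 1 / ((K : ℝ) + i + 1) := by
  induction K with
  | zero => simp [hK, harm]
  | succ K ih =>
    have e1 : hK (K + 1) j = hK K j + (1 / ((K : ℝ) + 1) - 1 / ((K : ℝ) + 1 + j)) := by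
      simp only [hK, sum_range_succ]
    have e2 : ∑ i ∈ range j, 1 / (((K + 1 : ℕ) : ℝ) + i + 1)
        = ∑ i ∈ range j, 1 / ((K : ℝ) + i + 1) - 1 / ((K : ℝ) + 1) + 1 / ((K : ℝ) + 1 + j) := by
      have h1 := sum_range_succ (fun i : ℕ => 1 / ((K : ℝ) + i + 1)) j
      have h2 := sum_range_succ' (fun i : ℕ => 1 / ((K : ℝ) + i + 1)) j
      have h3 : ∑ i ∈ range j, 1 / (((K + 1 : ℕ) : ℝ) + i + 1)
          = ∑ i ∈ range j, 1 / ((K : ℝ) + ((i + 1 : ℕ) : ℝ) + 1) :=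
        sum_congr rfl fun i _ => by push_cast; ring_nf
      rw [h3]
      rw [h1] at h2
      have h4 : (K : ℝ) + 1 + j = K + j + 1 := by ring
      rw [h4]
      simp only [Nat.cast_zero, add_zero] at h2
      linarith
    rw [e1, ih, e2]; ring

lemma hK_tendsto (j : ℕ) : Tendsto (fun K : ℕ => hK (K + 1) (j : ℝ)) atTop (𝓝 (harm j)) := by
  have : Tendsto (fun K : ℕ => hK K (j : ℝ)) atTop (𝓝 (harm j)) := by
    simp only [hK_nat]
    have h : Tendsto (fun K : ℕ => ∑ i ∈ range j, 1 / ((K : ℝ) + i + 1)) atTop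
        (𝓝 (∑ i ∈ range j, (0 : ℝ))) := by
      refine tendsto_finsetSum _ fun i _ => ?_
      refine tendsto_const_nhds.div_atTop ?_
      exact tendsto_atTop_add_const_right _ _ (tendsto_atTop_add_const_right _ _
        tendsto_natCast_atTop_atTop)
    simpa using tendsto_const_nhds.sub h
  exact this.comp (tendsto_add_atTop_nat 1)

lemma Del_tendsto (N : ℕ) (f : ℕ → ℕ → ℝ) (g : ℕ → ℝ)
    (h : ∀ j, Tendsto (fun K => f K j) atTop (𝓝 (g j))) :
    Tendsto (fun K => Del N (f K)) atTop (𝓝 (Del N g)) :=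
  tendsto_finsetSum _ fun j _ => (h j).const_mul _

lemma harm_ne (j : ℕ) : harm (j + 1) ≠ 0 := by linarith [one_le_harm j]

lemma inv_tendsto (j : ℕ) : Tendsto (fun K : ℕ => 1 / hK (K + 1) (j : ℝ)) atTop (𝓝 (1 / harm j)) := by
  rcases j with _ | j
  · simp [hK, harm]
  · exact tendsto_const_nhds.div (hK_tendsto _) (harm_ne j)

lemma inv_sq_tendsto (j : ℕ) :
    Tendsto (fun K : ℕ => 1 / hK (K + 1) (j : ℝ) ^ 2) atTop (𝓝 (1 / harm j ^ 2)) := by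
  simpa [one_div_pow] using (inv_tendsto j).pow 2

lemma hasSum_shift (p : ℕ) (hp : p ≠ 0) (z : ℝ) (h : HasSum (fun n : ℕ => 1 / (n : ℝ) ^ p) z) :
    HasSum (fun n : ℕ => 1 / ((n : ℝ) + 1) ^ p) z := by
  have := (hasSum_nat_add_iff' 1).2 h
  simpa [hp] using this

lemma Z2_hasSum : HasSum (fun n : ℕ => 1 / ((n : ℝ) + 1) ^ 2) (Real.pi ^ 2 / 6) :=
  hasSum_shift 2 (by norm_num) _ hasSum_zeta_two

lemma Z2_tendsto : Tendsto (fun K => Z 2 (K + 1)) atTop (𝓝 (Real.pi ^ 2 / 6)) :=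
  (Z2_hasSum.tendsto_sum_nat).comp (tendsto_add_atTop_nat 1)

lemma Z4_tendsto : Tendsto (fun K => Z 4 (K + 1)) atTop (𝓝 (Real.pi ^ 4 / 90)) :=
  ((hasSum_shift 4 (by norm_num) _ hasSum_zeta_four).tendsto_sum_nat).comp (tendsto_add_atTop_nat 1)

lemma Z3_tendsto : Tendsto (fun K => Z 3 (K + 1)) atTop (𝓝 zeta3) := by
  have h : Summable (fun n : ℕ => 1 / ((n : ℝ) + 1) ^ 3) := by
    have := (summable_nat_add_iff 1).2 (Real.summable_one_div_nat_pow.2 (show 1 < 3 by norm_num))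
    simpa using this
  exact (h.hasSum.tendsto_sum_nat).comp (tendsto_add_atTop_nat 1)

lemma limitK (N : ℕ) (b r e : ℝ) (hb : b = 1 / (Real.pi ^ 2 / 6)) (hr : r = b ^ 2 * zeta3)
    (he : e = b ^ 2 * (Real.pi ^ 4 / 90) - b ^ 3 * zeta3 ^ 2) :
      |- Del (N + 1) (fun j => 1 / harm j) - b * harm (N + 1) - r| ≤ r / (N + 2) ∧
      |- Del (N + 1) (fun j => 1 / harm j ^ 2) - b ^ 2 * (harm (N + 1) ^ 2 + Z 2 (N + 1)) / 2
        - 2 * b * r * harm (N + 1) + 2 * b * e - r ^ 2| ≤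
        (2 * b * e + 2 * r ^ 2 + r ^ 2 * harm (N + 2)) / (N + 2) := by
  let bK : ℕ → ℝ := fun K => 1 / Z 2 (K + 1)
  let rK : ℕ → ℝ := fun K => bK K ^ 2 * Z 3 (K + 1)
  let eK : ℕ → ℝ := fun K => bK K ^ 2 * Z 4 (K + 1) - bK K ^ 3 * Z 3 (K + 1) ^ 2
  have tb : Tendsto bK atTop (𝓝 b) := by
    rw [hb]; exact tendsto_const_nhds.div Z2_tendsto (by positivity)
  have tr : Tendsto rK atTop (𝓝 r) := by
    rw [hr]; exact (tb.pow 2).mul Z3_tendsto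
  have te : Tendsto eK atTop (𝓝 e) := by
    rw [he]; exact ((tb.pow 2).mul Z4_tendsto).sub ((tb.pow 3).mul (Z3_tendsto.pow 2))
  have lev : ∀ K, 
      |- Del (N + 1) (fun j => 1 / hK (K + 1) j) - bK K * harm (N + 1) - rK K| ≤ rK K / (N + 2) ∧
      |- Del (N + 1) (fun j => 1 / hK (K + 1) j ^ 2)
          - bK K ^ 2 * (harm (N + 1) ^ 2 + Z 2 (N + 1)) / 2
        - 2 * bK K * rK K * harm (N + 1) + 2 * bK K * eK K - rK K ^ 2| ≤
        (2 * bK K * eK K + 2 * rK K ^ 2 + rK K ^ 2 * harm (N + 2)) / (N + 2) := by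
    intro K
    obtain ⟨b', r', e', h1, h2, h3, h4, h5⟩ := levelK K N
    have hz : Z 2 (K + 1) ≠ 0 := fun h => by rw [h] at h1; simp at h1
    have eb : b' = bK K := by simp only [bK]; field_simp; linarith
    have er : r' = rK K := by
      simp only [rK]; rw [← eb]
      linear_combination b' * h2 - r' * h1
    have ee : e' = eK K := by
      simp only [eK]; rw [← eb]
      have er' : r' = b' ^ 2 * Z 3 (K + 1) := by linear_combination b' * h2 - r' * h1
      linear_combination b' * h3 - e' * h1 - b' * Z 3 (K + 1) * er'
    rw [eb, er, ee] at h5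
    rw [eb, er] at h4
    exact ⟨h4, h5⟩
  have td1 := Del_tendsto (N + 1) _ _ inv_tendsto
  have td2 := Del_tendsto (N + 1) _ _ inv_sq_tendsto
  constructor
  · exact le_of_tendsto_of_tendsto' ((td1.neg.sub (tb.mul_const _)).sub tr).abs
      (tr.div_const _) (fun K => (lev K).1)
  · refine le_of_tendsto_of_tendsto' (b := atTop) ?_ ?_ (fun K => (lev K).2)
    · exact ((((td2.neg.sub (((tb.pow 2).mul_const _).div_const _)).sub
        (((tb.const_mul 2).mul tr).mul_const _)).add ((tb.const_mul 2).mul te)).sub (tr.pow 2)).abs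
    · exact ((((tb.const_mul 2).mul te).add ((tr.pow 2).const_mul 2)).add
        ((tr.pow 2).mul_const _)).div_const _

lemma S_eq (N : ℕ) : S (N + 2) = - Del (N + 1) (fun j => 1 / harm j) := by
  have : Icc 1 (N + 2 - 1) = Ico 1 (N + 1 + 1) := by ext; simp
  rw [S, this, sum_Ico_eq_sum_range, Del, sum_range_succ']
  simp only [harm, range_zero, sum_empty, div_zero, mul_zero, add_zero, ← sum_neg_distrib]
  refine sum_congr (by simp) fun j _ => ?_
  rw [show 1 + j = j + 1 by ring, show N + 2 - 1 = N + 1 by omega, pow_succ, Nat.add_sub_cancel]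
  ring

lemma S₂_eq (N : ℕ) : S₂ (N + 2) = 2 * - Del (N + 1) (fun j => 1 / harm j ^ 2) := by
  have : Icc 1 (N + 2 - 1) = Ico 1 (N + 1 + 1) := by ext; simp
  rw [S₂, this, sum_Ico_eq_sum_range, Del, sum_range_succ']
  have h0 : harm 0 = 0 := by simp [harm]
  simp only [h0, ne_eq, OfNat.ofNat_ne_zero, not_false_eq_true, zero_pow, div_zero, mul_zero, add_zero,
    ← sum_neg_distrib, mul_sum]
  refine sum_congr (by simp) fun j _ => ?_
  rw [show 1 + j = j + 1 by ring, show N + 2 - 1 = N + 1 by omega, pow_succ, Nat.add_sub_cancel]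
  ring

lemma Z2_tail (N : ℕ) : |Z 2 (N + 1) - Real.pi ^ 2 / 6| ≤ 1 / ((N : ℝ) + 1) := by
  have up : ∀ M, Z 2 (N + 1 + M) ≤ Z 2 (N + 1) + (1 / (N + 1) - 1 / ((N : ℝ) + 1 + M)) := by
    intro M
    induction M with
    | zero => simp
    | succ M ih =>
      have e : Z 2 (N + 1 + (M + 1)) = Z 2 (N + 1 + M) + 1 / (((N + 1 + M : ℕ) : ℝ) + 1) ^ 2 := by
        rw [← add_assoc]; simp only [Z, sum_range_succ]
      rw [e]
      push_cast
      have : 1 / ((N : ℝ) + 1 + M + 1) ^ 2 ≤ 1 / ((N : ℝ) + 1 + M) - 1 / ((N : ℝ) + 1 + (M + 1)) := by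
        rw [div_sub_div _ _ (by positivity) (by positivity), div_le_div_iff₀ (by positivity) (by positivity)]
        nlinarith [show (0 : ℝ) ≤ N + 1 + M by positivity]
      linarith
  have t : Tendsto (fun M => Z 2 (N + 1 + M)) atTop (𝓝 (Real.pi ^ 2 / 6)) := by
    have := (Z2_hasSum.tendsto_sum_nat).comp (tendsto_add_atTop_nat (N + 1))
    refine this.congr fun M => ?_
    simp only [Function.comp, Z]; rw [add_comm M]
  have h1 : Real.pi ^ 2 / 6 ≤ Z 2 (N + 1) + 1 / (N + 1) := by
    refine le_of_tendsto' t fun M => (up M).trans ?_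
    have : (0 : ℝ) ≤ 1 / ((N : ℝ) + 1 + M) := by positivity
    linarith
  have h2 : Z 2 (N + 1) ≤ Real.pi ^ 2 / 6 :=
    sum_le_hasSum _ (fun _ _ => by positivity) Z2_hasSum
  have : (0 : ℝ) ≤ 1 / ((N : ℝ) + 1) := by positivity
  rw [abs_le]; constructor <;> linarith

lemma harm_eq (n : ℕ) : harm n = ((harmonic n : ℚ) : ℝ) := by
  simp [harm, harmonic]

set_option maxHeartbeats 1000000 in
lemma main1 : ∃ C : ℝ, ∀ n : ℕ, 2 ≤ n →
      |S₂ n - S n ^ 2 - (2 * zeta3 / (Real.pi ^ 2 / 6) ^ 3) * harm (n - 1)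
          - 5 * zeta3 ^ 2 / (Real.pi ^ 2 / 6) ^ 4 + 18 / (5 * Real.pi ^ 2)|
        ≤ C * Real.log n / n := by
  obtain ⟨b, hb⟩ : ∃ b, b = 1 / (Real.pi ^ 2 / 6) := ⟨_, rfl⟩
  obtain ⟨r, hr⟩ : ∃ r, r = b ^ 2 * zeta3 := ⟨_, rfl⟩
  obtain ⟨e, he⟩ : ∃ e, e = b ^ 2 * (Real.pi ^ 4 / 90) - b ^ 3 * zeta3 ^ 2 := ⟨_, rfl⟩
  have z3 : 0 ≤ zeta3 := tsum_nonneg fun _ => by positivity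
  have b0 : 0 ≤ b := by rw [hb]; positivity
  have r0 : 0 ≤ r := by rw [hr]; positivity
  refine ⟨4 * b ^ 2 + (8 * |b * e| + 8 * r ^ 2 + 6 * r ^ 2) + 2 * (3 * b + 2 * r) * r + 2 * r ^ 2, ?_⟩
  intro n hn
  obtain ⟨N, rfl⟩ := Nat.exists_eq_add_of_le hn
  rw [add_comm 2 N]
  obtain ⟨h1, h2⟩ := limitK N b r e hb hr he
  have h3 := Z2_tail N
  rw [← S_eq] at h1
  have eS2 : - Del (N + 1) (fun j => 1 / harm j ^ 2) = S₂ (N + 2) / 2 := by rw [S₂_eq]; ring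
  rw [eS2] at h2
  rw [show N + 2 - 1 = N + 1 by omega]
  set s := S (N + 2)
  set s2 := S₂ (N + 2)
  set h := harm (N + 1)
  set n : ℝ := ((N + 2 : ℕ) : ℝ) with hn'
  have en : (N : ℝ) + 2 = n := by rw [hn']; push_cast; ring
  rw [en] at h1 h2
  have n0 : 2 ≤ n := by rw [← en]; linarith [show (0 : ℝ) ≤ N by positivity]
  set L := Real.log n with hL
  have L1 : 1 ≤ 2 * L := by
    have := Real.log_le_log (by norm_num) n0
    have := Real.log_two_gt_d9
    linarith
  have hh2 : harm (N + 2) ≤ 3 * L := by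
    have := harmonic_le_one_add_log (N + 2)
    rw [← harm_eq] at this
    linarith
  have hh1 : h ≤ 3 * L := by
    refine le_trans ?_ hh2
    rw [harm_succ (N + 1)]
    have : (0 : ℝ) ≤ 1 / (((N + 1 : ℕ) : ℝ) + 1) := by positivity
    linarith
  have h0 : 0 ≤ h := harm_nonneg _
  have h3' : |Z 2 (N + 1) - Real.pi ^ 2 / 6| ≤ 2 / n := by
    refine h3.trans ?_
    rw [div_le_div_iff₀ (by positivity) (by positivity), ← en]
    linarith [show (0 : ℝ) ≤ N by positivity]
  set ε1 := s - b * h - r with hε1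
  set ε2 := s2 / 2 - b ^ 2 * (h ^ 2 + Z 2 (N + 1)) / 2 - 2 * b * r * h + 2 * b * e - r ^ 2 with hε2
  set ε3 := Z 2 (N + 1) - Real.pi ^ 2 / 6 with hε3
  have key : s2 - s ^ 2 - (2 * zeta3 / (Real.pi ^ 2 / 6) ^ 3) * h
          - 5 * zeta3 ^ 2 / (Real.pi ^ 2 / 6) ^ 4 + 18 / (5 * Real.pi ^ 2)
      = b ^ 2 * ε3 + 2 * ε2 - 2 * (b * h + r) * ε1 - ε1 ^ 2 := by
    have c1 : 2 * zeta3 / (Real.pi ^ 2 / 6) ^ 3 = 2 * b * r := by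
      rw [hr, hb]; field_simp
    have c2 : 5 * zeta3 ^ 2 / (Real.pi ^ 2 / 6) ^ 4 - 18 / (5 * Real.pi ^ 2)
        = b ^ 2 * (Real.pi ^ 2 / 6) - 4 * b * e + r ^ 2 := by
      rw [he, hr, hb]; field_simp; ring
    rw [c1, sub_add, c2, hε1, hε2, hε3]; ring
  rw [key]
  have m1 : |b ^ 2 * ε3| ≤ 4 * b ^ 2 * L / n := by
    rw [abs_mul, abs_of_nonneg (by positivity)]
    calc b ^ 2 * |ε3| ≤ b ^ 2 * (2 / n) := by gcongr
      _ = 2 * b ^ 2 * 1 / n := by ring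
      _ ≤ 2 * b ^ 2 * (2 * L) / n := by gcongr
      _ = _ := by ring
  have m2 : |2 * ε2| ≤ (8 * |b * e| + 8 * r ^ 2 + 6 * r ^ 2) * L / n := by
    rw [abs_mul, abs_of_nonneg (by norm_num : (0 : ℝ) ≤ 2)]
    calc 2 * |ε2| ≤ 2 * ((2 * b * e + 2 * r ^ 2 + r ^ 2 * harm (N + 2)) / n) := by gcongr
      _ ≤ 2 * ((2 * |b * e| * (2 * L) + 2 * r ^ 2 * (2 * L) + r ^ 2 * (3 * L)) / n) := by
        have p1 : 2 * b * e ≤ 2 * |b * e| * (2 * L) := by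
          have q1 := le_abs_self (b * e)
          have q2 := mul_le_mul_of_nonneg_left L1 (abs_nonneg (b * e))
          linarith
        have p2 : 2 * r ^ 2 ≤ 2 * r ^ 2 * (2 * L) := by
          have q2 := mul_le_mul_of_nonneg_left L1 (sq_nonneg r)
          linarith
        have p3 : r ^ 2 * harm (N + 2) ≤ r ^ 2 * (3 * L) :=
          mul_le_mul_of_nonneg_left hh2 (sq_nonneg r)
        exact mul_le_mul_of_nonneg_left
          (div_le_div_of_nonneg_right (add_le_add (add_le_add p1 p2) p3) (by linarith)) (by norm_num)
      _ = _ := by ring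
  have m3 : |2 * (b * h + r) * ε1| ≤ 2 * (3 * b + 2 * r) * r * L / n := by
    rw [abs_mul, abs_of_nonneg (by positivity)]
    calc 2 * (b * h + r) * |ε1| ≤ 2 * (b * (3 * L) + r * (2 * L)) * (r / n) := by
          have q2 := mul_le_mul_of_nonneg_left L1 r0
          have q3 := mul_le_mul_of_nonneg_left hh1 b0
          exact mul_le_mul (by linarith) h1 (abs_nonneg _) (by positivity)
      _ = _ := by ring
  have m4 : |ε1 ^ 2| ≤ 2 * r ^ 2 * L / n := by
    rw [abs_pow]
    calc |ε1| ^ 2 ≤ (r / n) ^ 2 := by gcongr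
      _ = r ^ 2 * (1 / n) / n := by ring
      _ ≤ r ^ 2 * (2 * L) / n := by
        gcongr
        rw [div_le_iff₀ (by positivity)]; nlinarith
      _ = _ := by ring
  have e5 : (4 * b ^ 2 + (8 * |b * e| + 8 * r ^ 2 + 6 * r ^ 2) + 2 * (3 * b + 2 * r) * r + 2 * r ^ 2) * L / n
      = 4 * b ^ 2 * L / n + (8 * |b * e| + 8 * r ^ 2 + 6 * r ^ 2) * L / n
        + 2 * (3 * b + 2 * r) * r * L / n + 2 * r ^ 2 * L / n := by ring
  rw [e5]
  rw [abs_le] at *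
  constructor <;> linarith [m1.1, m1.2, m2.1, m2.2, m3.1, m3.2, m4.1, m4.2]

lemma harm_log (n : ℕ) (hn : 2 ≤ n) :
    |harm (n - 1) - (Real.log n + Real.eulerMascheroniConstant)| ≤ 2 * Real.log n / n := by
  obtain ⟨m, rfl⟩ := Nat.exists_eq_add_of_le hn
  have h1 := Real.eulerMascheroniSeq_lt_eulerMascheroniConstant (m + 1)
  have h2 := Real.eulerMascheroniConstant_lt_eulerMascheroniSeq' (m + 2)
  rw [Real.eulerMascheroniSeq, ← harm_eq] at h1
  rw [Real.eulerMascheroniSeq', if_neg (by omega), ← harm_eq, harm_succ (m + 1)] at h2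
  rw [show 2 + m - 1 = m + 1 by omega, show 2 + m = m + 2 by omega]
  push_cast at *
  rw [show (m : ℝ) + 1 + 1 = m + 2 by ring] at *
  have n0 : (2 : ℝ) ≤ (m : ℝ) + 2 := by linarith [show (0 : ℝ) ≤ m by positivity]
  have := Real.log_le_log (by norm_num) n0
  have := Real.log_two_gt_d9
  have h3 : 1 / ((m : ℝ) + 2) ≤ 2 * Real.log (m + 2) / (m + 2) := by
    gcongr; linarith
  have : (0 : ℝ) ≤ 1 / ((m : ℝ) + 2) := by positivity
  rw [abs_le]; constructor <;> linarith

end Aux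

/--
With `S(n)` and `S₂(n)` as above, there is a constant `C` such that for all `n ≥ 2`,
`|S₂(n) - S(n)² - (2ζ(3)/ζ(2)³)·h_{n-1} - 5ζ(3)²/ζ(2)⁴ + 18/(5π²)| ≤ C · (log n)/n`.
In particular
`S₂(n) - S(n)² = (2ζ(3)/ζ(2)³)·log n + (2ζ(3)/ζ(2)³)·γ + 5ζ(3)²/ζ(2)⁴ − 18/(5π²) + O((log n)/n)`,
with `γ` the Euler–Mascheroni constant.
-/
theorem stmt16 :
    (∃ C : ℝ, ∀ n : ℕ, 2 ≤ n →
      |S₂ n - S n ^ 2 - (2 * zeta3 / (Real.pi ^ 2 / 6) ^ 3) * harm (n - 1)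
          - 5 * zeta3 ^ 2 / (Real.pi ^ 2 / 6) ^ 4 + 18 / (5 * Real.pi ^ 2)|
        ≤ C * Real.log n / n) ∧
    (∃ C : ℝ, ∀ n : ℕ, 2 ≤ n →
      |S₂ n - S n ^ 2
          - (2 * zeta3 / (Real.pi ^ 2 / 6) ^ 3) *
              (Real.log n + Real.eulerMascheroniConstant)
          - 5 * zeta3 ^ 2 / (Real.pi ^ 2 / 6) ^ 4 + 18 / (5 * Real.pi ^ 2)|
        ≤ C * Real.log n / n) := by
  obtain ⟨C, hC⟩ := Aux.main1
  refine ⟨⟨C, hC⟩, C + 2 * |2 * zeta3 / (Real.pi ^ 2 / 6) ^ 3|, fun n hn => ?_⟩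
  have h1 := hC n hn
  have h2 := Aux.harm_log n hn
  set k := 2 * zeta3 / (Real.pi ^ 2 / 6) ^ 3
  set l := Real.log n + Real.eulerMascheroniConstant
  have h3 : |k * (harm (n - 1) - l)| ≤ |k| * (2 * Real.log n / n) := by
    rw [abs_mul]; gcongr
  have e : S₂ n - S n ^ 2 - k * l - 5 * zeta3 ^ 2 / (Real.pi ^ 2 / 6) ^ 4 + 18 / (5 * Real.pi ^ 2)
      = (S₂ n - S n ^ 2 - k * harm (n - 1) - 5 * zeta3 ^ 2 / (Real.pi ^ 2 / 6) ^ 4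
          + 18 / (5 * Real.pi ^ 2)) + k * (harm (n - 1) - l) := by ring
  rw [e]
  refine (abs_add_le _ _).trans ((add_le_add h1 h3).trans (le_of_eq ?_))
  ring
end

section
/- For n ≥ 2 and real z < 1 define M_n(z) := 1 + Σ_{j=1}^{n-1} (-1)^{j-1} C(n-1, j) · z/(h_j - z), where h_j = Σ_{i=1}^j 1/i. Fix a real number z with z < 1 and z ≠ 0, and let ρ = ρ(z) be the unique real number in (-1, 1) with ψ(1+ρ) - ψ(1) = z. Let σ* := 1 + |t₁| where t₁ is the unique root in (-1, 0) of ψ(t) = ψ(2) (numerically σ* ≐ 1.457). Then there is a constant C (depending on z) such that for all n ≥ 2, |M_n(z) - (-z·Γ(-ρ)/ψ'(1+ρ)) · Γ(n)/Γ(n-ρ)| ≤ C · n^{-σ*}. -/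
/-- The digamma function on the reals: `ψ(x) = Γ'(x)/Γ(x)`. -/
noncomputable def digamma (x : ℝ) : ℝ := deriv Real.Gamma x / Real.Gamma x

/-- `M_n(z) = 1 + Σ_{j=1}^{n-1} (-1)^{j-1} C(n-1,j) · z/(h_j - z)`
(equal to `E[e^{zD_n}]` in the paper). -/
noncomputable def M (n : ℕ) (z : ℝ) : ℝ :=
  1 + ∑ j ∈ Finset.Icc 1 (n - 1),
        (-1 : ℝ) ^ (j - 1) * ((n - 1).choose j) * (z / (harm j - z))

open Finset Filter Topology


lemma dg_add_one (x : ℝ) (hx : ∀ m : ℕ, x ≠ -m) : digamma (x + 1) = digamma x + 1 / x := by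
  have hx0 : x ≠ 0 := by simpa using hx 0
  have hG : Real.Gamma x ≠ 0 := Real.Gamma_ne_zero hx
  have hd : deriv Real.Gamma (x + 1) = Real.Gamma x + x * deriv Real.Gamma x := by
    rw [← deriv_comp_add_const]
    have : (fun y => Real.Gamma (y + 1)) =ᶠ[𝓝 x] fun y => y * Real.Gamma y := by
      filter_upwards [isOpen_ne.mem_nhds hx0] with y hy
      exact Real.Gamma_add_one hy
    rw [this.deriv_eq]
    have h := (hasDerivAt_id x).mul (Real.differentiableAt_Gamma hx).hasDerivAt
    have h2 := h.deriv
    simp only [id, one_mul] at h2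
    exact h2
  unfold digamma
  rw [hd, Real.Gamma_add_one hx0]
  field_simp
  ring

lemma dg_mono {x y : ℝ} (hx : 0 < x) (hxy : x ≤ y) : digamma x ≤ digamma y := by
  have hne : ∀ w : ℝ, 0 < w → ∀ m : ℕ, w ≠ -m := by
    intro w hw m h
    have : (0:ℝ) ≤ m := m.cast_nonneg
    linarith
  have key : ∀ w : ℝ, 0 < w → HasDerivAt (Real.log ∘ Real.Gamma) (digamma w) w := by
    intro w hw
    have h := (Real.differentiableAt_Gamma (hne w hw)).hasDerivAt.log (Real.Gamma_pos_of_pos hw).ne'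
    exact h
  have hm := Real.convexOn_log_Gamma.monotoneOn_deriv
    (fun w hw => (key w hw).differentiableAt)
  have := hm (Set.mem_Ioi.2 hx) (Set.mem_Ioi.2 (hx.trans_le hxy)) hxy
  rwa [(key x hx).deriv, (key y (hx.trans_le hxy)).deriv] at this

lemma dg_add_nat (x : ℝ) (hx : 0 < x) (K : ℕ) :
    digamma (x + K) = digamma x + ∑ i ∈ range K, 1 / (x + i) := by
  induction K with
  | zero => simp
  | succ K ih =>
    rw [sum_range_succ, ← add_assoc, ← ih, ← dg_add_one]
    · push_cast; ring_nf
    · intro m h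
      have : (0:ℝ) ≤ m := m.cast_nonneg
      have : (0:ℝ) ≤ K := K.cast_nonneg
      linarith

lemma dg_nat (j : ℕ) : digamma (1 + j) - digamma 1 = harm j := by
  rw [dg_add_nat 1 one_pos, harm]
  simp [add_comm]

noncomputable def HK (K : ℕ) (s : ℝ) : ℝ := ∑ i ∈ range K, (1 / ((i:ℝ) + 1) - 1 / (i + 1 + s))

lemma HK_tendsto (s : ℝ) (hs : -1 < s) :
    Tendsto (fun K => HK K s) atTop (𝓝 (digamma (1 + s) - digamma 1)) := by
  obtain ⟨m, hm⟩ := exists_nat_ge |s|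
  have hsm : s ≤ m := (le_abs_self s).trans hm
  have h1 : ∀ K, HK K s = (digamma (1 + s) - digamma 1) + (digamma (1 + K) - digamma (1 + s + K)) := by
    intro K
    rw [dg_add_nat 1 one_pos, dg_add_nat (1+s) (by linarith), HK, sum_sub_distrib]
    have : ∀ i : ℕ, (i:ℝ) + 1 + s = 1 + s + i := fun i => by ring
    have h' : ∀ i : ℕ, (i:ℝ) + 1 = 1 + i := fun i => by ring
    simp only [this]
    simp only [h']
    ring
  have h2 : Tendsto (fun K : ℕ => digamma (1 + K) - digamma (1 + s + K)) atTop (𝓝 0) := by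
    have hz : Tendsto (fun K : ℕ => ((m:ℝ) + 1) / K) atTop (𝓝 0) :=
      tendsto_const_div_atTop_nhds_zero_nat _
    have hz' := hz.neg
    rw [neg_zero] at hz'
    refine tendsto_of_tendsto_of_tendsto_of_le_of_le' hz' hz ?_ ?_
    all_goals
      filter_upwards [eventually_ge_atTop 1] with K hK
      have hK0 : (1:ℝ) ≤ K := by exact_mod_cast hK
      have e : digamma (K + (m + 1 : ℕ)) ≤ digamma K + (m+1) / K := by
        rw [dg_add_nat K (by linarith)]
        have : ∑ i ∈ range (m+1), 1 / ((K:ℝ) + i) ≤ ∑ i ∈ range (m+1), 1 / (K:ℝ) := by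
          gcongr with i hi
          have : (0:ℝ) ≤ i := i.cast_nonneg
          linarith
        rw [sum_const, card_range, nsmul_eq_mul] at this
        push_cast at this
        rw [div_eq_mul_one_div ((m:ℝ)+1)]
        linarith
      push_cast at e
      have m0 : (0:ℝ) ≤ m := m.cast_nonneg
      have a1 : digamma K ≤ digamma (1 + s + K) := dg_mono (by linarith) (by linarith)
      have a2 : digamma (1 + s + K) ≤ digamma (K + (m+1)) := dg_mono (by linarith) (by linarith)
      have a3 : digamma K ≤ digamma (1 + K) := dg_mono (by linarith) (by linarith)
      have a4 : digamma (1 + K) ≤ digamma (K + (m+1)) := dg_mono (by linarith) (by linarith)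
      linarith
  have := h2.const_add (digamma (1 + s) - digamma 1)
  rw [add_zero] at this
  exact this.congr (fun K => (h1 K).symm)

lemma HK_tendsto_t (t : ℝ) (ht : t ∈ Set.Ioo (-1:ℝ) 0) :
    Tendsto (fun K => HK K (t - 1)) atTop (𝓝 (digamma t - digamma 1)) := by
  have h := HK_tendsto t ht.1
  have hr : digamma (1 + t) = digamma t + 1 / t := by
    rw [add_comm]
    apply dg_add_one
    intro m hm
    have h1 := ht.1
    have h2 := ht.2
    rw [hm] at h1 h2
    rcases Nat.eq_zero_or_pos m with h0 | h0
    · subst h0; simp at h2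
    · have : (1:ℝ) ≤ m := by exact_mod_cast h0
      linarith
  have h1 : ∀ K, HK K (t - 1) = HK K t - 1 / t + 1 / (K + t) := by
    intro K
    induction K with
    | zero => simp [HK]
    | succ K ih =>
      have e1 : ∀ u, HK (K+1) u = HK K u + (1 / ((K:ℝ) + 1) - 1 / (K + 1 + u)) := fun u => by
        rw [HK, sum_range_succ, ← HK]
      rw [e1, e1, ih]
      push_cast
      ring
  have h3 : Tendsto (fun K : ℕ => 1 / ((K:ℝ) + t)) atTop (𝓝 0) := by
    simp only [one_div]
    exact tendsto_inv_atTop_zero.comp (tendsto_atTop_add_const_right _ _ tendsto_natCast_atTop_atTop)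
  have h4 := (h.sub_const (1/t)).add h3
  rw [hr] at h4
  have e : digamma t + 1 / t - digamma 1 - 1 / t + 0 = digamma t - digamma 1 := by ring
  rw [e] at h4
  exact h4.congr (fun K => (h1 K).symm)

lemma dg_deriv (ρ : ℝ) (hρ : -1 < ρ) :
    Tendsto (fun K : ℕ => ∑ i ∈ range K, 1 / ((i:ℝ) + 1 + ρ)^2) atTop (𝓝 (deriv digamma (1 + ρ))) ∧
      0 < deriv digamma (1 + ρ) := by
  obtain ⟨a, ha1, ha3⟩ := exists_between (lt_min hρ (by norm_num : (-1:ℝ) < 0))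
  have ha2 : a < ρ := ha3.trans_le (min_le_left _ _)
  have ha0 : a < 0 := ha3.trans_le (min_le_right _ _)
  have hpos : ∀ (i : ℕ) (y : ℝ), a < y → 0 < (i:ℝ) + 1 + y := by
    intro i y hy
    have : (0:ℝ) ≤ i := i.cast_nonneg
    linarith
  have hu : Summable (fun i : ℕ => 1 / ((i:ℝ) + 1 + a)^2) := by
    have := (Real.summable_one_div_nat_add_rpow (1 + a) 2).2 (by norm_num)
    refine this.congr (fun i => ?_)
    rw [Real.rpow_two, sq_abs, add_assoc]
  have hg : ∀ (i : ℕ) (y : ℝ), y ∈ Set.Ioi (a) →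
      HasDerivAt (fun s : ℝ => 1 / ((i:ℝ) + 1) - 1 / (i + 1 + s)) (1 / ((i:ℝ) + 1 + y)^2) y := by
    intro i y hy
    have h := (((hasDerivAt_id y).const_add ((i:ℝ)+1)).inv (hpos i y hy).ne').const_sub (1 / ((i:ℝ) + 1))
    have e : -(-1 / ((i:ℝ) + 1 + id y)^2) = 1 / ((i:ℝ) + 1 + y)^2 := by simp [neg_div]
    rw [e] at h
    refine h.congr_of_eventuallyEq (Eventually.of_forall fun s => ?_)
    simp
  have hb : ∀ (i : ℕ) (y : ℝ), y ∈ Set.Ioi (a) →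
      ‖1 / ((i:ℝ) + 1 + y)^2‖ ≤ 1 / ((i:ℝ) + 1 + a)^2 := by
    intro i y hy
    have h0 : 0 < (i:ℝ) + 1 + a := by
      have : (0:ℝ) ≤ i := i.cast_nonneg
      linarith
    have := hpos i y hy
    have hy' : a < y := hy
    rw [Real.norm_of_nonneg (by positivity)]
    gcongr
  have h0 : Summable (fun i : ℕ => 1 / ((i:ℝ) + 1) - 1 / (i + 1 + (0:ℝ))) := by
    simpa using (summable_zero : Summable (fun _ : ℕ => (0:ℝ)))
  have hD := hasDerivAt_tsum_of_isPreconnected hu isOpen_Ioi isPreconnected_Ioi hg hb (Set.mem_Ioi.2 ha0) h0 (Set.mem_Ioi.2 ha2)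
  have hS : ∀ y ∈ Set.Ioi a, ∑' i : ℕ, (1 / ((i:ℝ) + 1) - 1 / (i + 1 + y)) = digamma (1 + y) - digamma 1 := by
    intro y hy
    have hs := summable_of_summable_hasDerivAt_of_isPreconnected hu isOpen_Ioi isPreconnected_Ioi hg hb (Set.mem_Ioi.2 ha0) h0 hy
    exact tendsto_nhds_unique hs.hasSum.tendsto_sum_nat (HK_tendsto y (ha1.trans hy))
  have hD2 : HasDerivAt (fun y => digamma (1 + y) - digamma 1) (∑' i : ℕ, 1 / ((i:ℝ) + 1 + ρ)^2) ρ := by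
    refine hD.congr_of_eventuallyEq ?_
    filter_upwards [Ioi_mem_nhds ha2] with y hy
    exact (hS y hy).symm
  have hD3 := hD2.deriv
  rw [deriv_sub_const, deriv_comp_const_add] at hD3
  have hs : Summable (fun i : ℕ => 1 / ((i:ℝ) + 1 + ρ)^2) :=
    Summable.of_norm_bounded hu (fun i => hb i ρ ha2)
  rw [hD3]
  refine ⟨hs.hasSum.tendsto_sum_nat, hs.tsum_pos (fun i => ?_) 0 ?_⟩
  · positivity
  · have := hpos 0 ρ ha2
    positivity
lemma pf (K : ℕ) (hK : 0 < K) (p s : ℕ → ℝ) (c : ℝ) (hc : c ≠ 0)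
    (hs : Set.InjOn s (range K)) (hsp : ∀ k ∈ range K, ∀ i ∈ range K, s k ≠ p i)
    (hG : ∀ k ∈ range K, c - ∑ i ∈ range K, 1 / (s k - p i) = 0)
    (x : ℝ) (hxp : ∀ i ∈ range K, x ≠ p i) (hxs : ∀ k ∈ range K, x ≠ s k) :
    1 / (c - ∑ i ∈ range K, 1 / (x - p i)) =
      1 / c + ∑ k ∈ range K, (1 / ∑ i ∈ range K, 1 / (s k - p i)^2) * (1 / (x - s k)) := by
  set P := Lagrange.nodal (range K) p with hP
  set Q := Lagrange.nodal (range K) s with hQ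
  have hPd : ∀ y, (∀ i ∈ range K, y ≠ p i) →
      P.derivative.eval y = P.eval y * ∑ i ∈ range K, 1 / (y - p i) := by
    intro y hy
    rw [hP, Lagrange.derivative_nodal, Polynomial.eval_finsetSum, mul_sum]
    refine sum_congr rfl fun i hi => ?_
    rw [Lagrange.eval_nodal, Lagrange.eval_nodal, ← mul_prod_erase _ _ hi]
    have := sub_ne_zero.2 (hy i hi)
    field_simp
  have hP0 : ∀ y, (∀ i ∈ range K, y ≠ p i) → P.eval y ≠ 0 := by
    intro y hy
    exact Lagrange.eval_nodal_not_at_node hy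
  have hdegPQ : (P - Q).degree < ((range K).card : ℕ) := by
    have := Polynomial.degree_sub_lt_left (p := P) (q := Q)
      (by rw [hP, hQ, Lagrange.degree_nodal, Lagrange.degree_nodal])
      Lagrange.nodal_ne_zero
      (by rw [Lagrange.nodal_monic.leadingCoeff, Lagrange.nodal_monic.leadingCoeff])
    rwa [hP, Lagrange.degree_nodal] at this
  have hR : Polynomial.C c * P - P.derivative = Polynomial.C c * Q := by
    refine Polynomial.eq_of_degree_sub_lt_of_eval_index_eq _ hs ?_ ?_
    · have e : Polynomial.C c * P - P.derivative - Polynomial.C c * Q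
          = Polynomial.C c * (P - Q) - P.derivative := by ring
      rw [e]
      refine (Polynomial.degree_sub_le _ _).trans_lt (max_lt ?_ ?_)
      · rwa [Polynomial.degree_C_mul hc]
      · have := Polynomial.degree_derivative_lt (p := P) Lagrange.nodal_ne_zero
        rwa [hP, Lagrange.degree_nodal] at this
    · intro k hk
      rw [Polynomial.eval_sub, Polynomial.eval_mul, Polynomial.eval_mul, Polynomial.eval_C,
        hPd _ (hsp k hk), hQ, Lagrange.eval_nodal_at_node hk]
      have := hG k hk
      linear_combination (P.eval (s k)) * this
  have hRe : ∀ y, (∀ i ∈ range K, y ≠ p i) →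
      (c - ∑ i ∈ range K, 1 / (y - p i)) * P.eval y = c * Q.eval y := by
    intro y hy
    have := congrArg (Polynomial.eval y) hR
    rw [Polynomial.eval_sub, Polynomial.eval_mul, Polynomial.eval_mul, Polynomial.eval_C,
        hPd _ hy] at this
    linear_combination this
  have hder : ∀ k ∈ range K, (∑ i ∈ range K, 1 / (s k - p i)^2) * P.eval (s k)
      = c * Q.derivative.eval (s k) := by
    intro k hk
    have h1 : HasDerivAt (fun y => c - ∑ i ∈ range K, 1 / (y - p i))
        (∑ i ∈ range K, 1 / (s k - p i)^2) (s k) := by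
      have : HasDerivAt (fun y => c - ∑ i ∈ range K, 1 / (y - p i))
        (- ∑ i ∈ range K, -1 / (s k - p i)^2) (s k) := by
        refine HasDerivAt.const_sub _ (HasDerivAt.fun_sum fun i hi => ?_)
        have h := ((hasDerivAt_id (s k)).sub_const (p i)).inv (sub_ne_zero.2 (hsp k hk i hi))
        refine h.congr_of_eventuallyEq (Eventually.of_forall fun y => ?_)
        simp
      convert this using 1
      rw [← sum_neg_distrib]
      refine sum_congr rfl fun i _ => ?_
      ring
    have h2 := h1.mul (P.hasDerivAt (s k))
    have h3 := (Q.hasDerivAt (s k)).const_mul c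
    have hev : ∀ᶠ y in 𝓝 (s k), ∀ i ∈ range K, y ≠ p i := by
      rw [Filter.eventually_all_finset]
      intro i hi
      exact isOpen_ne.mem_nhds (hsp k hk i hi)
    have h4 := h2.congr_of_eventuallyEq (f₁ := fun y => c * Q.eval y)
      (by filter_upwards [hev] with y hy
          exact (hRe y hy).symm)
    have h5 := h4.unique h3
    rw [hG k hk, zero_mul, add_zero] at h5
    exact h5
  have hint := Lagrange.eq_interpolate_of_eval_eq (f := P - Q) (fun k => P.eval (s k)) hs hdegPQ
    (fun k hk => by rw [Polynomial.eval_sub, hQ, Lagrange.eval_nodal_at_node hk, sub_zero])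
  have hint2 := congrArg (Polynomial.eval x) hint
  rw [Lagrange.eval_interpolate_not_at_node _ hxs, Polynomial.eval_sub, ← hQ] at hint2
  have hQx : Q.eval x ≠ 0 := Lagrange.eval_nodal_not_at_node hxs
  have hPx := hP0 x hxp
  have hGx : c - ∑ i ∈ range K, 1 / (x - p i) = c * Q.eval x / P.eval x := by
    rw [eq_div_iff hPx]; exact hRe x hxp
  have hsum : ∑ k ∈ range K, Lagrange.nodalWeight (range K) s k * (x - s k)⁻¹ * P.eval (s k)
      = c * ∑ k ∈ range K, (1 / ∑ i ∈ range K, 1 / (s k - p i)^2) * (1 / (x - s k)) := by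
    rw [mul_sum]
    refine sum_congr rfl fun k hk => ?_
    have hd := hder k hk
    have hw := Lagrange.nodalWeight_ne_zero hs hk
    rw [Lagrange.nodalWeight_eq_eval_derivative_nodal hk, ← hQ] at hw ⊢
    have hq0 : Q.derivative.eval (s k) ≠ 0 := fun h => hw (by rw [h, inv_zero])
    have hp0 := hP0 _ (hsp k hk)
    have hS : (∑ i ∈ range K, 1 / (s k - p i)^2) = c * Q.derivative.eval (s k) / P.eval (s k) := by
      rw [eq_div_iff hp0]; exact hd
    rw [hS]
    have := sub_ne_zero.2 (hxs k hk)
    field_simp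
  rw [hsum] at hint2
  rw [hGx]
  have : P.eval x = Q.eval x * (1 + c * ∑ k ∈ range K, (1 / ∑ i ∈ range K, 1 / (s k - p i)^2) * (1 / (x - s k))) := by
    linear_combination hint2
  generalize (∑ k ∈ range K, (1 / ∑ i ∈ range K, 1 / (s k - p i)^2) * (1 / (x - s k))) = S at *
  rw [one_div_div, this]
  field_simp

lemma one_root (K k : ℕ) (hk : 1 ≤ k) (hkK : k < K) (c : ℝ) :
    ∃ s ∈ Set.Ioo (-((k:ℝ) + 1)) (-(k:ℝ)), c - ∑ i ∈ range K, 1 / ((i:ℝ) + 1 + s) = 0 := by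
  set E := ((range K).erase k).erase (k - 1) with hE
  have hkm : k - 1 ∈ (range K).erase k := by
    rw [mem_erase, mem_range]; omega
  have hk0 : ((k - 1 : ℕ) : ℝ) = k - 1 := by push_cast [hk]; ring
  have hsplit : ∀ y : ℝ, ∑ i ∈ range K, 1 / ((i:ℝ) + 1 + y)
      = 1 / ((k:ℝ) + 1 + y) + (1 / ((k:ℝ) + y) + ∑ i ∈ E, 1 / ((i:ℝ) + 1 + y)) := by
    intro y
    rw [← add_sum_erase _ _ (mem_range.2 hkK), ← add_sum_erase _ _ hkm, hk0]
    simp only [sub_add_cancel, hE]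
  have hne : ∀ y ∈ Set.Icc (-((k:ℝ) + 1)) (-(k:ℝ)), ∀ i ∈ E, (i:ℝ) + 1 + y ≠ 0 := by
    intro y hy i hi h
    rw [hE, mem_erase, mem_erase] at hi
    have h1 : i + 1 < k ∨ k + 1 < i + 1 := by omega
    rcases h1 with h1 | h1
    · have : (i:ℝ) + 1 < k := by exact_mod_cast h1
      linarith [hy.2]
    · have : (k:ℝ) + 1 < i + 1 := by exact_mod_cast h1
      linarith [hy.1]
  set φ : ℝ → ℝ := fun y => (y + k) * (y + k + 1) * (c - ∑ i ∈ E, 1 / ((i:ℝ) + 1 + y)) - (2 * y + 2 * k + 1) with hφ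
  have hcont : ContinuousOn φ (Set.Icc (-((k:ℝ) + 1)) (-(k:ℝ))) := by
    refine ContinuousOn.sub (ContinuousOn.mul (by fun_prop) (ContinuousOn.sub continuousOn_const ?_)) (by fun_prop)
    refine continuousOn_finsetSum _ fun i hi => ?_
    exact ContinuousOn.div continuousOn_const (by fun_prop) (fun y hy => hne y hy i hi)
  have hivt := intermediate_value_Ioo' (by linarith : -((k:ℝ) + 1) ≤ -(k:ℝ)) hcont
  have ha : φ (-((k:ℝ) + 1)) = 1 := by simp only [hφ]; ring
  have hb : φ (-(k:ℝ)) = -1 := by simp only [hφ]; ring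
  rw [ha, hb] at hivt
  obtain ⟨y, hy, hy0⟩ := hivt (⟨by norm_num, by norm_num⟩ : (0:ℝ) ∈ Set.Ioo (-1:ℝ) 1)
  refine ⟨y, hy, ?_⟩
  rw [hsplit]
  have h1 : (k:ℝ) + 1 + y ≠ 0 := by intro h; linarith [hy.1]
  have h2 : (k:ℝ) + y ≠ 0 := by intro h; linarith [hy.2]
  simp only [hφ] at hy0
  generalize (∑ i ∈ E, 1 / ((i:ℝ) + 1 + y)) = S at *
  field_simp
  linear_combination hy0

lemma alt_sum (N : ℕ) : ∀ (x : ℝ), (∀ i : ℕ, x + i ≠ 0) →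
    ∑ j ∈ range (N + 1), (-1:ℝ)^j * (N.choose j) * (1 / (j + x))
      = N.factorial / ∏ i ∈ range (N + 1), (x + i) := by
  induction N with
  | zero => intro x hx; simp
  | succ N ih =>
    intro x hx
    have hx1 : ∀ i : ℕ, x + 1 + i ≠ 0 := by
      intro i h
      apply hx (i + 1)
      push_cast
      linarith
    have h1 := ih x hx
    have h2 := ih (x + 1) hx1
    have e : ∑ j ∈ range (N + 1 + 1), (-1:ℝ)^j * ((N+1).choose j) * (1 / (j + x))
        = ∑ j ∈ range (N + 1), (-1:ℝ)^j * (N.choose j) * (1 / (j + x))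
          - ∑ j ∈ range (N + 1), (-1:ℝ)^j * (N.choose j) * (1 / (j + (x + 1))) := by
      rw [sum_range_succ']
      have : ∀ j : ℕ, (-1:ℝ)^(j+1) * ((N+1).choose (j+1)) * (1 / ((j+1 : ℕ) + x))
         = -((-1:ℝ)^j * (N.choose j) * (1 / (j + (x + 1)))) + (-1:ℝ)^(j+1) * (N.choose (j+1)) * (1 / ((j+1 : ℕ) + x)) := by
        intro j
        rw [Nat.choose_succ_succ]
        push_cast
        rw [show (j:ℝ) + 1 + x = j + (x + 1) by ring]
        ring
      simp only [this]
      rw [sum_add_distrib, sum_neg_distrib]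
      have h3 : ∑ j ∈ range (N + 1), (-1:ℝ)^j * (N.choose j) * (1 / (j + x)) =
          ∑ j ∈ range (N + 1 + 1), (-1:ℝ)^j * (N.choose j) * (1 / (j + x)) := by
        rw [sum_range_succ _ (N+1)]
        simp
      rw [h3, sum_range_succ' (fun j : ℕ => (-1:ℝ)^j * (N.choose j) * (1 / (j + x)))]
      simp only [Nat.choose_zero_right]
      ring
    rw [e, h1, h2]
    have p1 : ∏ i ∈ range (N + 1 + 1), (x + i) = (∏ i ∈ range (N + 1), (x + i)) * (x + (N + 1)) := by
      rw [prod_range_succ]; push_cast; rfl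
    have p2 : ∏ i ∈ range (N + 1 + 1), (x + i) = (∏ i ∈ range (N + 1), (x + 1 + i)) * x := by
      rw [prod_range_succ']; push_cast
      simp only [add_zero]
      congr 1
      refine prod_congr rfl fun i _ => by ring
    have n1 : ∏ i ∈ range (N + 1), (x + i) ≠ 0 := prod_ne_zero_iff.2 fun i _ => hx i
    have n2 : ∏ i ∈ range (N + 1), (x + 1 + i) ≠ 0 := prod_ne_zero_iff.2 fun i _ => hx1 i
    have n3 : x + (N + 1) ≠ 0 := by have := hx (N+1); push_cast at this; exact this
    have n0 : x ≠ 0 := by simpa using hx 0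
    have f : ((N+1).factorial : ℝ) = (N + 1) * N.factorial := by
      rw [Nat.factorial_succ]; push_cast; rfl
    rw [p1, f]
    have p3 := p1.symm.trans p2
    generalize ∏ i ∈ range (N + 1), (x + i) = A at *
    generalize ∏ i ∈ range (N + 1), (x + 1 + i) = B at *
    field_simp
    linear_combination -p3

lemma beta_bound (σ : ℝ) (hσ : 0 < σ) : ∃ C : ℝ, 0 ≤ C ∧ ∀ N : ℕ,
    (N.factorial : ℝ) / ∏ i ∈ range (N + 1), (σ + i) ≤ C * ((N:ℝ) + 1) ^ (-σ) := by
  obtain ⟨C0, hC0⟩ := (Real.GammaSeq_tendsto_Gamma σ).bddAbove_range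
  have hb : ∀ n, Real.GammaSeq σ n ≤ C0 := fun n => hC0 ⟨n, rfl⟩
  have hpr : ∀ n : ℕ, 0 < ∏ i ∈ range n, (σ + i) := fun n => prod_pos fun i _ => by positivity
  have hC00 : 0 ≤ C0 := by
    refine le_trans ?_ (hb 1)
    have := hpr 2
    unfold Real.GammaSeq
    positivity
  refine ⟨C0 * (σ + 1), by positivity, fun N => ?_⟩
  have h := hb (N + 1)
  unfold Real.GammaSeq at h
  rw [prod_range_succ, Nat.factorial_succ] at h
  push_cast at h
  have hp := hpr (N + 1)
  have hN : (0:ℝ) < (N:ℝ) + 1 := by positivity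
  have hpow : (0:ℝ) < ((N:ℝ) + 1) ^ σ := by positivity
  rw [Real.rpow_neg hN.le, ← div_eq_mul_inv, div_le_div_iff₀ hp hpow]
  rw [div_le_iff₀ (by positivity)] at h
  have hN1 : (1:ℝ) ≤ (N:ℝ) + 1 := by have : (0:ℝ) ≤ N := N.cast_nonneg
                                     linarith
  have h2 : σ + ((N:ℝ) + 1) ≤ (σ + 1) * (N + 1) := by nlinarith
  generalize ∏ i ∈ range (N + 1), (σ + (i:ℝ)) = A at *
  have h3 : C0 * (A * (σ + ((N:ℝ) + 1))) ≤ C0 * (A * ((σ + 1) * (N + 1))) := by gcongr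
  have h4 : ((N:ℝ) + 1) * ((N.factorial : ℝ) * ((N:ℝ) + 1) ^ σ) ≤ ((N:ℝ) + 1) * (C0 * (σ + 1) * A) := by
    linarith
  exact le_of_mul_le_mul_left h4 hN

lemma gamma_prod (x : ℝ) (hx : ∀ i : ℕ, x + i ≠ 0) (n : ℕ) :
    Real.Gamma (x + n) = (∏ i ∈ range n, (x + i)) * Real.Gamma x := by
  induction n with
  | zero => simp
  | succ n ih =>
    rw [prod_range_succ]
    push_cast
    rw [← add_assoc, Real.Gamma_add_one (hx n), ih]
    ring

lemma core (K N : ℕ) (hK : 2 ≤ K) (hN : 1 ≤ N) (ρ σ : ℝ) (hρ : ρ ∈ Set.Ioo (-1:ℝ) 1) (hρ0 : ρ ≠ 0)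
    (hσ : σ ∈ Set.Ioo (1:ℝ) 2) (hGσ : 0 < HK K (-σ) - HK K ρ) :
    |∑ j ∈ range (N + 1), (-1:ℝ)^j * (N.choose j) * (1 / (HK K j - HK K ρ)) -
      (1 / ∑ i ∈ range K, 1 / ((i:ℝ) + 1 + ρ)^2) * (N.factorial / ∏ i ∈ range (N + 1), (-ρ + i))|
    ≤ (1 / (HK K 0 - HK K ρ) + (1 / ∑ i ∈ range K, 1 / ((i:ℝ) + 1 + ρ)^2) / ρ) *
      (σ * (N.factorial / ∏ i ∈ range (N + 1), (σ + i))) := by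
  obtain ⟨hρ1, hρ2⟩ := hρ
  obtain ⟨hσ1, hσ2⟩ := hσ
  have hnn : ∀ i : ℕ, (0:ℝ) ≤ i := fun i => i.cast_nonneg
  set c : ℝ := ∑ i ∈ range K, 1 / ((i:ℝ) + 1 + ρ) with hc
  have hHK : ∀ x, HK K x - HK K ρ = c - ∑ i ∈ range K, 1 / ((i:ℝ) + 1 + x) := by
    intro x
    rw [HK, HK, sum_sub_distrib, sum_sub_distrib, ← hc]
    ring
  simp only [hHK] at hGσ ⊢
  have hcpos : 0 < c := by
    refine sum_pos (fun i _ => ?_) ⟨0, mem_range.2 (by omega)⟩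
    have : 0 < (i:ℝ) + 1 + ρ := by linarith [hnn i]
    positivity
  have hroots : ∀ k : ℕ, ∃ y : ℝ, (k = 0 → y = ρ) ∧ (1 ≤ k → k < K →
      y ∈ Set.Ioo (-((k:ℝ) + 1)) (-(k:ℝ)) ∧ c - ∑ i ∈ range K, 1 / ((i:ℝ) + 1 + y) = 0) := by
    intro k
    by_cases h : 1 ≤ k ∧ k < K
    · obtain ⟨y, hy1, hy2⟩ := one_root K k h.1 h.2 c
      exact ⟨y, fun h0 => by omega, fun _ _ => ⟨hy1, hy2⟩⟩
    · exact ⟨ρ, fun _ => rfl, fun h1 h2 => absurd ⟨h1, h2⟩ h⟩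
  choose s hs0 hs1 using hroots
  have hs00 : s 0 = ρ := hs0 0 rfl
  have hroot : ∀ k ∈ range K, c - ∑ i ∈ range K, 1 / ((i:ℝ) + 1 + s k) = 0 := by
    intro k hk
    rcases Nat.eq_zero_or_pos k with h | h
    · subst h; rw [hs00, hc, sub_self]
    · exact (hs1 k h (mem_range.1 hk)).2
  have hlt : ∀ k l, k < l → l < K → s l < s k := by
    intro k l hkl hl
    have h1 := (hs1 l (by omega) hl).1.2
    have hl1 : (k:ℝ) + 1 ≤ l := by exact_mod_cast hkl
    rcases Nat.eq_zero_or_pos k with h | h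
    · subst h
      rw [hs00]
      push_cast at hl1
      linarith
    · have h2 := (hs1 k h (by omega)).1.1
      linarith
  have hinj : Set.InjOn s (range K) := by
    intro k hk l hl hkl
    simp only [coe_range, Set.mem_Iio] at hk hl
    rcases lt_trichotomy k l with h | h | h
    · exact absurd hkl (hlt k l h hl).ne'
    · exact h
    · exact absurd hkl (hlt l k h hk).ne
  have hsp : ∀ k ∈ range K, ∀ i ∈ range K, s k ≠ -((i:ℝ) + 1) := by
    intro k hk i hi h
    rcases Nat.eq_zero_or_pos k with h0 | h0
    · subst h0; rw [hs00] at h; linarith [hnn i]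
    · have h1 := (hs1 k h0 (mem_range.1 hk)).1
      rw [h] at h1
      have a1 : ((i + 1 : ℕ):ℝ) < ((k + 1 : ℕ) : ℝ) := by push_cast; linarith [h1.1]
      have a2 : (k:ℝ) < ((i + 1 : ℕ):ℝ) := by push_cast; linarith [h1.2]
      have a1' := Nat.cast_lt.1 a1
      have a2' := Nat.cast_lt.1 a2
      omega
  set r : ℕ → ℝ := fun k => 1 / ∑ i ∈ range K, 1 / ((i:ℝ) + 1 + s k)^2 with hr
  have hrnn : ∀ k, 0 ≤ r k := by
    intro k
    have : 0 ≤ ∑ i ∈ range K, 1 / ((i:ℝ) + 1 + s k)^2 := sum_nonneg fun i _ => by positivity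
    simp only [hr]; positivity
  have hr0 : 1 / ∑ i ∈ range K, 1 / ((i:ℝ) + 1 + ρ)^2 = r 0 := by simp only [hr, hs00]
  rw [hr0]
  have hsneg : ∀ k ∈ range K, k ≠ 0 → s k < -1 := by
    intro k hk h
    have h1 := (hs1 k (by omega) (mem_range.1 hk)).1.2
    have : (1:ℝ) ≤ k := by exact_mod_cast Nat.one_le_iff_ne_zero.2 h
    linarith
  have hjs : ∀ j : ℕ, ∀ k ∈ range K, (j:ℝ) ≠ s k := by
    intro j k hk h
    by_cases h0 : k = 0
    · subst h0
      rw [hs00] at h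
      rcases Nat.eq_zero_or_pos j with h1 | h1
      · subst h1; exact hρ0 (by rw [← h]; simp)
      · have : (1:ℝ) ≤ j := by exact_mod_cast h1
        linarith
    · linarith [hsneg k hk h0, hnn j]
  have hpf : ∀ j : ℕ, 1 / (c - ∑ i ∈ range K, 1 / ((i:ℝ) + 1 + j)) =
      1 / c + ∑ k ∈ range K, r k * (1 / (j - s k)) := by
    intro j
    have e : ∀ (i : ℕ) (y : ℝ), (i:ℝ) + 1 + y = y - (-((i:ℝ) + 1)) := fun i y => by ring
    have := pf K (by omega) (fun i => -((i:ℝ) + 1)) s c hcpos.ne' hinj hsp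
      (fun k hk => by rw [← hroot k hk]; simp only [e]) j
      (fun i hi h => by linarith [hnn i, hnn j]) (hjs j)
    simp only [hr, e]
    exact this
  have hsk : ∀ k ∈ range K, ∀ i : ℕ, -s k + i ≠ 0 := by
    intro k hk i h
    exact hjs i k hk (by linarith)
  set b : ℝ → ℝ := fun x => N.factorial / ∏ i ∈ range (N + 1), (x + i) with hb
  have hS : ∑ j ∈ range (N + 1), (-1:ℝ)^j * (N.choose j) * (1 / (c - ∑ i ∈ range K, 1 / ((i:ℝ) + 1 + j)))
      = ∑ k ∈ range K, r k * b (-s k) := by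
    simp only [hpf, mul_add, sum_add_distrib]
    have z1 : ∑ j ∈ range (N + 1), (-1:ℝ)^j * (N.choose j) * (1 / c) = 0 := by
      rw [← sum_mul]
      have := Int.alternating_sum_range_choose_of_ne (n := N) (by omega)
      have h2 : ∑ j ∈ range (N + 1), (-1:ℝ)^j * (N.choose j) = 0 := by exact_mod_cast this
      rw [h2, zero_mul]
    rw [z1, zero_add]
    simp only [mul_sum]
    rw [sum_comm]
    refine sum_congr rfl fun k hk => ?_
    rw [hb]
    simp only
    rw [← alt_sum N (-s k) (hsk k hk), mul_sum]
    refine sum_congr rfl fun j _ => ?_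
    rw [← sub_eq_add_neg]
    ring
  have h0K : 0 ∈ range K := mem_range.2 (by omega)
  have h00 := hpf 0
  rw [← add_sum_erase _ (fun k => r k * (1 / (((0:ℕ):ℝ) - s k))) h0K, hs00] at h00
  push_cast at h00
  rw [hS, ← add_sum_erase _ (fun k => r k * b (-s k)) h0K, hs00]
  have hcancel : r 0 * b (-ρ) + ∑ k ∈ (range K).erase 0, r k * b (-s k) - r 0 * (N.factorial / ∏ i ∈ range (N + 1), (-ρ + i))
     = ∑ k ∈ (range K).erase 0, r k * b (-s k) := by simp only [hb]; ring
  rw [hcancel]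
  have hs1σ : s 1 ≤ -σ := by
    by_contra hcon
    push Not at hcon
    have h1 := hs1 1 le_rfl (by omega)
    have hm : ∑ i ∈ range K, 1 / ((i:ℝ) + 1 + s 1) ≤ ∑ i ∈ range K, 1 / ((i:ℝ) + 1 + -σ) := by
      refine sum_le_sum fun i _ => ?_
      rcases Nat.eq_zero_or_pos i with h | h
      · subst h
        have h2 := h1.1.2
        push_cast at h2 ⊢
        apply one_div_le_one_div_of_neg_of_le <;> linarith
      · have : (1:ℝ) ≤ i := by exact_mod_cast h
        apply one_div_le_one_div_of_le <;> linarith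
    linarith [h1.2]
  have hsσ : ∀ k ∈ (range K).erase 0, σ ≤ -s k := by
    intro k hk
    rw [mem_erase, mem_range] at hk
    rcases Nat.lt_or_ge 1 k with h | h
    · linarith [hlt 1 k h hk.2]
    · have : k = 1 := by omega
      subst this; linarith
  have hbx : ∀ x : ℝ, σ ≤ x → 0 ≤ b x ∧ x * b x ≤ σ * b σ := by
    intro x hx
    have e : ∀ y : ℝ, 0 < y → y * b y = N.factorial / ∏ i ∈ range N, (y + (i + 1 : ℕ)) := by
      intro y hy
      simp only [hb]
      rw [prod_range_succ']
      push_cast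
      have : ∏ i ∈ range N, (y + ((i:ℝ) + 1)) ≠ 0 := prod_ne_zero_iff.2 fun i _ => by positivity
      rw [add_zero]
      field_simp
    constructor
    · simp only [hb]
      have : 0 < ∏ i ∈ range (N + 1), (x + (i:ℝ)) := prod_pos fun i _ => by
        have : 0 < x := by linarith
        positivity
      positivity
    · rw [e x (by linarith), e σ (by linarith)]
      have hp : 0 < ∏ i ∈ range N, (σ + ((i + 1 : ℕ):ℝ)) := prod_pos fun i _ => by positivity
      apply div_le_div_of_nonneg_left (by positivity) hp
      apply Finset.prod_le_prod
      · intro i _; positivity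
      · intro i _; linarith
  rw [abs_of_nonneg (sum_nonneg fun k hk => mul_nonneg (hrnn k) (hbx _ (hsσ k hk)).1)]
  have hle : ∑ k ∈ (range K).erase 0, r k * b (-s k) ≤
      ∑ k ∈ (range K).erase 0, r k * (1 / (0 - s k)) * (σ * b σ) := by
    refine sum_le_sum fun k hk => ?_
    have h1 := hsσ k hk
    have h2 := (hbx _ h1).2
    have hpos : 0 < 0 - s k := by linarith
    rw [mul_assoc]
    refine mul_le_mul_of_nonneg_left ?_ (hrnn k)
    rw [one_div_mul_eq_div, le_div_iff₀ hpos]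
    linarith
  refine hle.trans ?_
  rw [← sum_mul]
  refine mul_le_mul_of_nonneg_right ?_ (mul_nonneg (by linarith) (hbx σ le_rfl).1)
  rw [h00]
  have : 0 < 1 / c := by positivity
  have e2 : r 0 * (1 / (0 - ρ)) = - (r 0 / ρ) := by rw [zero_sub, one_div_neg_eq_neg_one_div]; ring
  rw [e2]
  linarith

lemma M_eq (N : ℕ) (z : ℝ) (hz0 : z ≠ 0) :
    M (N + 1) z = -z * ∑ j ∈ range (N + 1), (-1:ℝ)^j * (N.choose j) * (1 / (harm j - z)) := by
  unfold M
  rw [Nat.add_sub_cancel, sum_range_succ', mul_add]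
  have e : ∑ j ∈ Icc 1 N, (-1 : ℝ) ^ (j - 1) * (N.choose j) * (z / (harm j - z))
      = ∑ j ∈ range N, (-1 : ℝ) ^ j * (N.choose (j+1)) * (z / (harm (j+1) - z)) := by
    rw [← Finset.Ico_add_one_right_eq_Icc, sum_Ico_eq_sum_range]
    refine sum_congr (by simp) fun j _ => ?_
    rw [add_comm 1 j, Nat.add_sub_cancel]
  rw [e, mul_sum, add_comm]
  congr 1
  · refine sum_congr rfl fun j _ => ?_
    rw [pow_succ]
    ring
  · simp only [harm, range_zero, sum_empty]
    field_simp
    simp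

theorem stmt17 (z : ℝ) (hz : z < 1) (hz0 : z ≠ 0)
    (ρ : ℝ) (hρ : ρ ∈ Set.Ioo (-1:ℝ) 1) (hρeq : digamma (1 + ρ) - digamma 1 = z)
    (t₁ : ℝ) (ht₁ : t₁ ∈ Set.Ioo (-1:ℝ) 0) (ht₁eq : digamma t₁ = digamma 2) :
    ∃ C : ℝ, ∀ n : ℕ, 2 ≤ n →
      |M n z - (-z * Real.Gamma (-ρ) / deriv digamma (1 + ρ)) *
          (Real.Gamma (n : ℝ) / Real.Gamma ((n : ℝ) - ρ))|
        ≤ C * (n : ℝ) ^ (-(1 + |t₁|)) := by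
  have hρ0 : ρ ≠ 0 := by
    rintro rfl
    apply hz0
    rw [← hρeq]; simp
  set σ := 1 + |t₁| with hσd
  have hσt : σ = 1 - t₁ := by rw [hσd, abs_of_neg ht₁.2]; ring
  have hσ : σ ∈ Set.Ioo (1:ℝ) 2 := by
    rw [hσt]; constructor <;> linarith [ht₁.1, ht₁.2]
  obtain ⟨hder, hdpos⟩ := dg_deriv ρ hρ.1
  set d := deriv digamma (1 + ρ) with hd
  have hHρ : Tendsto (fun K => HK K ρ) atTop (𝓝 z) := by
    have := HK_tendsto ρ hρ.1
    rwa [hρeq] at this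
  have hHj : ∀ j : ℕ, Tendsto (fun K => HK K (j:ℝ) - HK K ρ) atTop (𝓝 (harm j - z)) := by
    intro j
    have := HK_tendsto (j:ℝ) (by have : (0:ℝ) ≤ j := j.cast_nonneg
                                 linarith)
    rw [dg_nat] at this
    exact this.sub hHρ
  have hHσ : Tendsto (fun K => HK K (-σ) - HK K ρ) atTop (𝓝 (1 - z)) := by
    have h := HK_tendsto_t t₁ ht₁
    have e1 : digamma t₁ - digamma 1 = 1 := by
      have := dg_nat 1
      rw [ht₁eq]
      norm_num [harm] at this
      exact this
    rw [e1] at h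
    rw [show -σ = t₁ - 1 by rw [hσt]; ring]
    exact h.sub hHρ
  have hne : ∀ j : ℕ, harm j - z ≠ 0 := by
    intro j
    rcases Nat.eq_zero_or_pos j with h | h
    · subst h; simpa [harm] using hz0
    · have : (1:ℝ) ≤ harm j := by
        unfold harm
        have := single_le_sum (f := fun i : ℕ => (1:ℝ) / (i + 1)) (fun i _ => by positivity) (mem_range.2 h)
        simpa using this
      intro h; linarith
  obtain ⟨Cσ, hCσ0, hCσ⟩ := beta_bound σ (by linarith [hσ.1])
  set T := 1 / (harm 0 - z) + (1 / d) / ρ with hT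
  refine ⟨|z| * |T| * σ * Cσ, fun n hn => ?_⟩
  obtain ⟨N, rfl⟩ : ∃ N, n = N + 1 := ⟨n - 1, by omega⟩
  have hN : 1 ≤ N := by omega
  have hρi : ∀ i : ℕ, -ρ + i ≠ 0 := by
    intro i h
    rcases Nat.eq_zero_or_pos i with h1 | h1
    · subst h1; exact hρ0 (by simpa using h)
    · have : (1:ℝ) ≤ i := by exact_mod_cast h1
      linarith [hρ.2]
  set B := (N.factorial : ℝ) / ∏ i ∈ range (N + 1), (-ρ + i) with hB
  set Bσ := (N.factorial : ℝ) / ∏ i ∈ range (N + 1), (σ + i) with hBσ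
  have hBσ0 : 0 ≤ Bσ := by
    have : 0 < ∏ i ∈ range (N + 1), (σ + (i:ℝ)) := prod_pos fun i _ => by
      have := hσ.1
      positivity
    positivity
  have hΓ : Real.Gamma (-ρ) ≠ 0 := by
    apply Real.Gamma_ne_zero
    intro m h
    exact hρi m (by linarith)
  have hmain : (-z * Real.Gamma (-ρ) / d) *
      (Real.Gamma ((N + 1 : ℕ) : ℝ) / Real.Gamma (((N + 1 : ℕ) : ℝ) - ρ)) = -z * ((1 / d) * B) := by
    have h1 := gamma_prod (-ρ) hρi (N + 1)
    rw [sub_eq_neg_add, h1]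
    have h2 : Real.Gamma ((N + 1 : ℕ) : ℝ) = N.factorial := by
      push_cast
      exact Real.Gamma_nat_eq_factorial N
    rw [h2, hB]
    have h3 : ∏ i ∈ range (N + 1), (-ρ + (i:ℝ)) ≠ 0 := prod_ne_zero_iff.2 fun i _ => hρi i
    generalize ∏ i ∈ range (N + 1), (-ρ + (i:ℝ)) = A at *
    field_simp
  rw [hmain, M_eq N z hz0, ← mul_sub, abs_mul, abs_neg]
  have hlim : |∑ j ∈ range (N + 1), (-1:ℝ)^j * (N.choose j) * (1 / (harm j - z)) - (1 / d) * B|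
      ≤ T * (σ * Bσ) := by
    have hr : Tendsto (fun K : ℕ => 1 / ∑ i ∈ range K, 1 / ((i:ℝ) + 1 + ρ)^2) atTop (𝓝 (1 / d)) :=
      tendsto_const_nhds.div hder hdpos.ne'
    have h0 := hHj 0
    push_cast at h0
    refine le_of_tendsto_of_tendsto (b := atTop)
      (f := fun K => |∑ j ∈ range (N + 1), (-1:ℝ)^j * (N.choose j) * (1 / (HK K j - HK K ρ)) -
        (1 / ∑ i ∈ range K, 1 / ((i:ℝ) + 1 + ρ)^2) * B|)
      (g := fun K => (1 / (HK K 0 - HK K ρ) + (1 / ∑ i ∈ range K, 1 / ((i:ℝ) + 1 + ρ)^2) / ρ) *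
        (σ * Bσ)) ?_ ?_ ?_
    · refine Tendsto.abs (Tendsto.sub (tendsto_finsetSum _ fun j _ => ?_) (hr.mul_const B))
      exact Tendsto.const_mul _ (tendsto_const_nhds.div (hHj j) (hne j))
    · exact ((Tendsto.div tendsto_const_nhds h0 (hne 0)).add (hr.div_const ρ)).mul_const _
    · filter_upwards [eventually_ge_atTop 2, hHσ.eventually_const_lt (by linarith : (0:ℝ) < 1 - z)] with K hK hK2
      exact core K N hK hN ρ σ hρ hρ0 hσ hK2
  have hb := hCσ N
  rw [← hBσ] at hb
  have hσ0 : 0 < σ := by linarith [hσ.1]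
  push_cast
  calc |z| * _ ≤ |z| * (T * (σ * Bσ)) := by gcongr
    _ ≤ |z| * (|T| * (σ * Bσ)) := by
        gcongr
        exact le_abs_self T
    _ ≤ |z| * (|T| * (σ * (Cσ * ((N:ℝ) + 1) ^ (-σ)))) := by gcongr
    _ = _ := by ring
end

section
/- Let μ be a σ-finite Borel measure on the interval (0,1) whose Mellin transform satisfies ∫₀¹ x^{s-1} dμ(x) = 1/(ψ(s) - ψ(1)) for every real s > 1. Then there is a constant C such that for all integers n ≥ 2, |∫₀¹ (1 - (1-x)^n - n·x·(1-x)^{n-1})/x dμ(x) - (6/π²)·n| ≤ C · n^{-|s₁|}, where s₁ ∈ (-1,0) is the unique root of ψ(s) = ψ(1) in (-1,0). -/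
open MeasureTheory

lemma spectral_aux (N : ℕ) (A : Matrix (Fin N) (Fin N) ℝ) (hA : A.IsHermitian) :
    ∃ (e : Fin N → Fin N → ℝ) (l : Fin N → ℝ),
      (∀ j k, ∑ i, A k i * e j i = l j * e j k) ∧
      (∀ u v : Fin N → ℝ, ∑ j, (∑ k, u k * e j k) * (∑ k, v k * e j k) = ∑ k, u k * v k) := by
  refine ⟨fun j k => hA.eigenvectorBasis j k, hA.eigenvalues, ?_, ?_⟩
  · intro j k
    have := congrFun (hA.mulVec_eigenvectorBasis j) k
    simpa [Matrix.mulVec, dotProduct] using this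
  · intro u v
    have := hA.eigenvectorBasis.sum_inner_mul_inner (WithLp.toLp 2 u) (WithLp.toLp 2 v)
    simp only [PiLp.inner_apply, RCLike.inner_apply, conj_trivial] at this
    rw [Finset.sum_congr rfl (fun k _ => mul_comm (u k) (v k)), ← this]
    refine Finset.sum_congr rfl fun j _ => ?_
    congr 1
    exact Finset.sum_congr rfl (fun k _ => mul_comm _ _)

/-- partial harmonic sums -/
noncomputable def HN (N : ℕ) : ℝ := ∑ k : Fin N, 1 / ((k : ℝ) + 1)
noncomputable def DN (N : ℕ) (s : ℝ) : ℝ := HN N - ∑ k : Fin N, 1 / ((k : ℝ) + s)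
noncomputable def ZN (N : ℕ) : ℝ := ∑ k : Fin N, 1 / ((k : ℝ) + 1) ^ 2

lemma HN_pos {N : ℕ} (hN : 0 < N) : 0 < HN N := by
  have : Nonempty (Fin N) := ⟨⟨0, hN⟩⟩
  exact Finset.sum_pos (fun k _ => by positivity) Finset.univ_nonempty

lemma ZN_pos {N : ℕ} (hN : 0 < N) : 0 < ZN N := by
  have : Nonempty (Fin N) := ⟨⟨0, hN⟩⟩
  exact Finset.sum_pos (fun k _ => by positivity) Finset.univ_nonempty

lemma DN_pos {N : ℕ} (hN : 0 < N) {s : ℝ} (hs : 1 < s) : 0 < DN N s := by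
  have : Nonempty (Fin N) := ⟨⟨0, hN⟩⟩
  rw [DN, HN, ← Finset.sum_sub_distrib]
  refine Finset.sum_pos (fun k _ => ?_) Finset.univ_nonempty
  have : (0:ℝ) ≤ k := by positivity
  rw [sub_pos]
  exact one_div_lt_one_div_of_lt (by positivity) (by linarith)

lemma DN_root {N : ℕ} (hN : 0 < N) {s : ℝ} (hs : 0 < s) (h : DN N s = 0) : s = 1 := by
  rcases lt_trichotomy s 1 with h1 | h1 | h1
  · exfalso
    have : Nonempty (Fin N) := ⟨⟨0, hN⟩⟩
    have : DN N s < 0 := by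
      rw [DN, HN, ← Finset.sum_sub_distrib]
      refine Finset.sum_neg (fun k _ => ?_) Finset.univ_nonempty
      have : (0:ℝ) ≤ k := by positivity
      rw [sub_neg]
      exact one_div_lt_one_div_of_lt (by positivity) (by linarith)
    linarith
  · exact h1
  · exact absurd h (DN_pos hN h1).ne'

lemma spectral (N : ℕ) (hN : 0 < N) :
    ∃ (r l : Fin N → ℝ), (∀ j, 0 ≤ r j) ∧
      (∀ j, r j ≠ 0 → DN N (l j) = 0 ∧ ∀ k : Fin N, (k : ℝ) + l j ≠ 0) ∧
      ∑ j, r j / l j = 1 / HN N ∧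
      (∀ s, 1 < s → ∑ j, r j / (s - l j) = 1 / DN N s - 1 / HN N) ∧
      ∑ j, (if l j = 1 then r j else 0) = 1 / ZN N := by
  have hH := HN_pos hN
  have hZ := ZN_pos hN
  let A : Matrix (Fin N) (Fin N) ℝ := Matrix.of fun k i => 1 / HN N - (if k = i then (k : ℝ) else 0)
  have hA : A.IsHermitian := by
    ext i k
    simp only [A, Matrix.conjTranspose_apply, Matrix.of_apply, star_trivial]
    by_cases h : i = k
    · simp [h]
    · simp [h, Ne.symm h]
  obtain ⟨e, l, he, hP⟩ := spectral_aux N A hA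
  set c : Fin N → ℝ := fun j => (∑ k, e j k) / HN N with hc
  have hsum : ∀ j, ∑ k, e j k = HN N * c j := fun j => by
    simp only [hc]; field_simp
  have key : ∀ (j k : Fin N), ((k : ℝ) + l j) * e j k = c j := by
    intro j k
    have := he j k
    simp only [A, Matrix.of_apply, sub_mul, Finset.sum_sub_distrib, ite_mul, zero_mul,
      Finset.sum_ite_eq, Finset.mem_univ, if_true, ← Finset.mul_sum] at this
    simp only [hc]
    rw [add_mul, ← this]; ring
  clear_value c
  have hroot : ∀ j, c j ≠ 0 → DN N (l j) = 0 ∧ ∀ k : Fin N, (k : ℝ) + l j ≠ 0 := by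
    intro j hj
    have h2 : ∀ k : Fin N, (k : ℝ) + l j ≠ 0 := fun k h => hj (by rw [← key j k, h, zero_mul])
    refine ⟨?_, h2⟩
    have h3 : ∀ k, e j k = c j * (1 / ((k : ℝ) + l j)) := fun k => by
      rw [← key j k]; field_simp [h2 k]
    have h4 := hsum j
    rw [Finset.sum_congr rfl (fun k _ => h3 k), ← Finset.mul_sum, mul_comm] at h4
    rw [DN, sub_eq_zero]
    exact (mul_right_cancel₀ hj h4).symm
  refine ⟨fun j => c j ^ 2, l, fun j => sq_nonneg _, fun j hj => hroot j (by simpa using hj), ?_, ?_, ?_⟩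
  · have h := hP (fun _ => 1) (fun k => if k = ⟨0, hN⟩ then 1 else 0)
    simp only [one_mul, ite_mul, zero_mul, Finset.sum_ite_eq', Finset.mem_univ, if_true] at h
    rw [eq_div_iff hH.ne', Finset.sum_mul, ← h]
    refine Finset.sum_congr rfl fun j _ => ?_
    rw [hsum]
    by_cases hj : c j = 0
    · simp [hj]
    · have h0 := key j ⟨0, hN⟩
      have h1 := (hroot j hj).2 ⟨0, hN⟩
      simp only [Nat.cast_zero, zero_add] at h0 h1
      field_simp
      rw [← h0]
  · intro s hs
    have hD := DN_pos hN hs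
    have hpos : ∀ k : Fin N, (0:ℝ) < (k : ℝ) + s := fun k => by positivity
    have h := hP (fun _ => 1) (fun k => 1 / ((k : ℝ) + s))
    have hterm : ∀ j, (∑ k, 1 * e j k) * (∑ k : Fin N, 1 / ((k : ℝ) + s) * e j k)
        = HN N * DN N s * (c j ^ 2 / (s - l j)) := by
      intro j
      simp only [one_mul]
      rw [hsum]
      by_cases hj : c j = 0
      · simp [hj]
      · have hl : l j < s := by
          by_contra hcon
          push Not at hcon
          have := DN_pos hN (lt_of_lt_of_le hs hcon)
          exact this.ne' (hroot j hj).1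
        have h5 : HN N * c j = c j * (∑ k : Fin N, 1 / ((k : ℝ) + s)) +
            (s - l j) * ∑ k : Fin N, 1 / ((k : ℝ) + s) * e j k := by
          rw [← hsum, Finset.mul_sum, Finset.mul_sum, ← Finset.sum_add_distrib]
          refine Finset.sum_congr rfl fun k _ => ?_
          rw [← key j k]
          have := (hpos k).ne'
          field_simp
          ring
        have h6 : s - l j ≠ 0 := (sub_pos.2 hl).ne'
        rw [DN]
        generalize (∑ k : Fin N, 1 / ((k : ℝ) + s) * e j k) = S2 at h5 ⊢
        generalize (∑ k : Fin N, 1 / ((k : ℝ) + s)) = S1 at h5 ⊢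
        rw [mul_assoc, mul_assoc]
        congr 1
        rw [mul_div_assoc', eq_div_iff h6]
        linear_combination (-1) * c j * h5
    rw [Finset.sum_congr rfl (fun j _ => hterm j), ← Finset.mul_sum] at h
    simp only [one_mul] at h
    have h7 : ∑ k : Fin N, 1 / ((k : ℝ) + s) = HN N - DN N s := by rw [DN]; ring
    rw [h7] at h
    field_simp
    linear_combination h
  · have h := hP (fun k => 1 / ((k : ℝ) + 1)) (fun k => 1 / ((k : ℝ) + 1))
    have hterm : ∀ j, (∑ k : Fin N, 1 / ((k : ℝ) + 1) * e j k)
        = if l j = 1 then c j * ZN N else 0 := by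
      intro j
      split_ifs with hl
      · rw [ZN, Finset.mul_sum]
        refine Finset.sum_congr rfl fun k _ => ?_
        have hk := key j k
        rw [hl] at hk
        rw [← hk]
        have : (k : ℝ) + 1 ≠ 0 := by positivity
        field_simp
      · have h5 : HN N * c j = c j * HN N +
            (1 - l j) * ∑ k : Fin N, 1 / ((k : ℝ) + 1) * e j k := by
          conv_lhs => rw [← hsum]
          rw [HN, Finset.mul_sum, Finset.mul_sum, ← Finset.sum_add_distrib]
          refine Finset.sum_congr rfl fun k _ => ?_
          rw [← key j k]
          have : (k : ℝ) + 1 ≠ 0 := by positivity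
          field_simp
          ring
        have h6 : (1 - l j) * ∑ k : Fin N, 1 / ((k : ℝ) + 1) * e j k = 0 := by linarith
        rcases mul_eq_zero.1 h6 with h7 | h7
        · exact absurd (by linarith) hl
        · exact h7
    have h8 : ∑ k : Fin N, 1 / ((k : ℝ) + 1) * (1 / ((k : ℝ) + 1)) = ZN N := by
      rw [ZN]; refine Finset.sum_congr rfl fun k _ => ?_
      field_simp
    rw [h8] at h
    have h9 : ZN N ^ 2 * ∑ j, (if l j = 1 then c j ^ 2 else 0) = ZN N := by
      rw [Finset.mul_sum]
      conv_rhs => rw [← h]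
      refine Finset.sum_congr rfl fun j _ => ?_
      rw [hterm]
      split_ifs <;> ring
    field_simp
    have : ZN N * (ZN N * ∑ j, (if l j = 1 then c j ^ 2 else 0)) = ZN N * 1 := by
      rw [mul_one]; linear_combination h9
    rw [mul_comm]
    exact mul_left_cancel₀ hZ.ne' this

lemma HN_succ (N : ℕ) : HN (N + 1) = HN N + 1 / ((N : ℝ) + 1) := by
  simp [HN, Fin.sum_univ_castSucc]

lemma DN_succ (N : ℕ) (s : ℝ) :
    DN (N + 1) s = DN N s + 1 / ((N : ℝ) + 1) - 1 / ((N : ℝ) + s) := by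
  simp [DN, HN_succ, Fin.sum_univ_castSucc]; ring

lemma digamma_add_one {s : ℝ} (hs : ∀ m : ℕ, s ≠ -m) :
    digamma (s + 1) = digamma s + 1 / s := by
  have hs0 : s ≠ 0 := by simpa using hs 0
  have hG : Real.Gamma s ≠ 0 := Real.Gamma_ne_zero hs
  have hd := (Real.differentiableAt_Gamma hs).hasDerivAt
  have h1 : HasDerivAt (fun x => x * Real.Gamma x) (1 * Real.Gamma s + s * deriv Real.Gamma s) s :=
    (hasDerivAt_id s).mul hd
  have h2 : (fun x => Real.Gamma (x + 1)) =ᶠ[nhds s] fun x => x * Real.Gamma x := by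
    filter_upwards [isOpen_ne.mem_nhds hs0] with x hx
    exact Real.Gamma_add_one hx
  have h3 : deriv Real.Gamma (s + 1) = 1 * Real.Gamma s + s * deriv Real.Gamma s := by
    rw [← h1.deriv, ← h2.deriv_eq, deriv_comp_add_const]
  rw [digamma, digamma, h3, Real.Gamma_add_one hs0]
  field_simp
  ring

lemma digamma_mono {a b : ℝ} (ha : 0 < a) (hab : a ≤ b) : digamma a ≤ digamma b := by
  have hd : ∀ x ∈ Set.Ioi (0:ℝ), HasDerivAt (Real.log ∘ Real.Gamma) (digamma x) x := by
    intro x hx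
    have h1 := (Real.differentiableAt_Gamma (s := x) (fun m => by
      have : (0:ℝ) < x := hx
      have h2 : (0:ℝ) ≤ m := by positivity
      linarith)).hasDerivAt
    exact h1.log (Real.Gamma_pos_of_pos hx).ne'
  have := Real.convexOn_log_Gamma.monotoneOn_deriv (fun x hx => (hd x hx).differentiableAt)
    (show a ∈ Set.Ioi (0:ℝ) from ha) (show b ∈ Set.Ioi (0:ℝ) from lt_of_lt_of_le ha hab) hab
  rwa [(hd a ha).deriv, (hd b (lt_of_lt_of_le ha hab)).deriv] at this

lemma digamma_shift {s : ℝ} (hs : ∀ m : ℕ, s ≠ -m) (N : ℕ) :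
    digamma (s + N) = digamma s + ∑ k : Fin N, 1 / ((k : ℝ) + s) := by
  induction N with
  | zero => simp
  | succ N ih =>
    rw [Fin.sum_univ_castSucc]
    push_cast
    rw [← add_assoc, digamma_add_one, ih]
    · simp only [Fin.val_castSucc, Fin.val_last]
      rw [add_comm s]; ring
    · intro m h
      exact hs (m + N) (by push_cast; linarith)

lemma ne_neg_nat_of_pos {s : ℝ} (hs : 0 < s) (m : ℕ) : s ≠ -m := by
  have h2 : (0:ℝ) ≤ m := by positivity
  linarith

lemma DN_eq {s : ℝ} (hs : ∀ m : ℕ, s ≠ -m) (N : ℕ) :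
    DN N s = (digamma s - digamma 1) + (digamma (1 + N) - digamma (s + N)) := by
  rw [digamma_shift hs, digamma_shift (ne_neg_nat_of_pos one_pos), DN, HN]
  ring

lemma digamma_nat (m : ℕ) : digamma ((m : ℝ) + 1) - digamma 1 = HN m := by
  rw [add_comm, digamma_shift (ne_neg_nat_of_pos one_pos), HN]; ring

lemma DN_root_nonneg {s : ℝ} (hs : s ∈ Set.Ioo (-1:ℝ) 0) (hr : digamma s = digamma 1)
    (N : ℕ) (hN : 0 < N) : 0 ≤ DN N s := by
  have hN1 : (1:ℝ) ≤ N := by exact_mod_cast hN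
  have hs' : ∀ m : ℕ, s ≠ -m := by
    intro m h
    obtain ⟨h1, h2⟩ := hs
    rw [h] at h1 h2
    have h3 : (m:ℝ) < 1 := by linarith
    have h4 : m = 0 := by
      have : m < 1 := by exact_mod_cast h3
      omega
    simp [h4] at h2
  rw [DN_eq hs', hr]
  have := digamma_mono (a := s + N) (b := 1 + N) (by linarith [hs.1]) (by linarith [hs.2])
  linarith

lemma DN_lt {N : ℕ} (hN : 0 < N) {s t : ℝ} (hs : -1 < s) (hst : s < t) (ht : t < 0) :
    DN N s < DN N t := by
  rw [DN, DN]
  have : Nonempty (Fin N) := ⟨⟨0, hN⟩⟩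
  have : ∑ k : Fin N, 1 / ((k : ℝ) + t) < ∑ k : Fin N, 1 / ((k : ℝ) + s) := by
    refine Finset.sum_lt_sum_of_nonempty Finset.univ_nonempty fun k _ => ?_
    rcases Nat.eq_zero_or_pos k.val with h | h
    · rw [h]
      simp only [Nat.cast_zero, zero_add]
      exact one_div_lt_one_div_of_neg_of_lt ht hst
    · have : (1:ℝ) ≤ (k:ℕ) := by exact_mod_cast h
      exact one_div_lt_one_div_of_lt (by linarith) (by linarith)
  linarith

lemma DN_nat_tendsto (m : ℕ) :
    Filter.Tendsto (fun N => DN N ((m : ℝ) + 1)) Filter.atTop (nhds (HN m)) := by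
  induction m with
  | zero =>
    have : ∀ N, DN N (((0:ℕ) : ℝ) + 1) = 0 := fun N => by simp [DN, HN]
    simp only [this]
    simp [HN]
  | succ m ih =>
    have h : ∀ N : ℕ, DN N (((m + 1 : ℕ) : ℝ) + 1)
        = DN N ((m : ℝ) + 1) + 1 / ((m : ℝ) + 1) - 1 / ((N : ℝ) + (m + 1)) := by
      intro N
      induction N with
      | zero => simp [DN, HN]
      | succ N ihN =>
        rw [DN_succ, DN_succ, ihN]
        push_cast
        rw [show (N : ℝ) + (m + 1 + 1) = N + 1 + (m + 1) by ring]
        ring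
    simp only [h]
    rw [HN_succ]
    have h0 : Filter.Tendsto (fun N : ℕ => 1 / ((N : ℝ) + (m + 1))) Filter.atTop (nhds 0) := by
      refine Filter.Tendsto.const_div_atTop ?_ _
      exact Filter.tendsto_atTop_add_const_right _ _ tendsto_natCast_atTop_atTop
    simpa using (ih.add_const (1 / ((m : ℝ) + 1))).sub h0

lemma HN_tendsto : Filter.Tendsto (fun N => 1 / HN N) Filter.atTop (nhds 0) := by
  refine Filter.Tendsto.const_div_atTop ?_ _
  have := Real.tendsto_sum_range_one_div_nat_succ_atTop
  refine this.congr fun N => ?_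
  rw [HN, Finset.sum_range]

lemma ZN_tendsto : Filter.Tendsto (fun N => 1 / ZN N) Filter.atTop (nhds (6 / Real.pi ^ 2)) := by
  have h1 : HasSum (fun n : ℕ => (1 : ℝ) / ((n : ℝ) + 1) ^ 2) (Real.pi ^ 2 / 6) := by
    have := (hasSum_nat_add_iff' (f := fun n : ℕ => (1 : ℝ) / (n : ℝ) ^ 2) 1).2 hasSum_zeta_two
    simpa using this
  have h2 : Filter.Tendsto ZN Filter.atTop (nhds (Real.pi ^ 2 / 6)) := by
    refine h1.tendsto_sum_nat.congr fun N => ?_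
    rw [ZN, Finset.sum_range]
  have h3 := (tendsto_const_nhds (x := (1:ℝ))).div h2 (by positivity)
  rwa [one_div_div] at h3

lemma ZN_ge {N : ℕ} (hN : 0 < N) : 1 ≤ ZN N := by
  have := Finset.single_le_sum (f := fun k : Fin N => 1 / (((k:ℕ) : ℝ) + 1) ^ 2)
    (fun k _ => by positivity) (Finset.mem_univ (⟨0, hN⟩ : Fin N))
  simpa [ZN] using this

/-- the product `∏_{i=2}^{n+1} i / (i + t)` -/
noncomputable def WN (t : ℝ) : ℕ → ℝ
  | 0 => 1
  | n + 1 => WN t n * (((n : ℝ) + 2) / ((n : ℝ) + 2 + t))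

lemma WN_pos {t : ℝ} (ht : -2 < t) (n : ℕ) : 0 < WN t n := by
  induction n with
  | zero => simp [WN]
  | succ n ih =>
    have : 0 < (n : ℝ) + 2 + t := by
      have : (0:ℝ) ≤ n := by positivity
      linarith
    rw [WN]; positivity

lemma WN_anti {t u : ℝ} (ht : -2 < t) (h : t ≤ u) (n : ℕ) : WN u n ≤ WN t n := by
  induction n with
  | zero => simp [WN]
  | succ n ih =>
    have h0 : (0:ℝ) ≤ n := by positivity
    have : 0 < (n : ℝ) + 2 + t := by linarith
    have := (WN_pos ht n).le
    rw [WN, WN]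
    gcongr
    exact div_nonneg (by linarith) (by linarith)

lemma WN_neg_one (n : ℕ) : WN (-1) n = (n : ℝ) + 1 := by
  induction n with
  | zero => simp [WN]
  | succ n ih =>
    rw [WN, ih]
    have : (n : ℝ) + 2 + -1 ≠ 0 := by
      have : (0:ℝ) ≤ n := by positivity
      linarith
    field_simp
    push_cast; ring

lemma WN_bound {t : ℝ} (ht : 0 < t) (ht1 : t < 1) (n : ℕ) :
    WN t n ≤ 2 ^ t * ((n : ℝ) + 2) ^ (-t) := by
  induction n with
  | zero =>
    rw [WN]
    simp only [Nat.cast_zero, zero_add]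
    rw [← Real.rpow_add two_pos]; simp
  | succ n ih =>
    rw [WN]
    have hb := rpow_one_add_le_one_add_mul_self (s := 1 / ((n:ℝ) + 2))
      (by have : (0:ℝ) ≤ 1 / ((n:ℝ) + 2) := by positivity
          linarith) ht.le ht1.le
    have e1 : 1 + 1 / ((n:ℝ) + 2) = ((n:ℝ) + 3) / (n + 2) := by field_simp; ring
    rw [e1, Real.div_rpow (by positivity) (by positivity)] at hb
    have e2 : (1 + t * (1 / ((n:ℝ) + 2))) = ((n:ℝ) + 2 + t) / (n + 2) := by field_simp
    rw [e2] at hb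
    have p3 : 0 < ((n:ℝ) + 3) ^ t := by positivity
    have p2 : 0 < ((n:ℝ) + 2) ^ t := by positivity
    have h2 : ((n : ℝ) + 2) / ((n : ℝ) + 2 + t) ≤ ((n:ℝ) + 2) ^ t / ((n:ℝ) + 3) ^ t := by
      rw [div_le_div_iff₀ (by positivity) (by positivity)] at hb ⊢
      linarith
    calc WN t n * (((n : ℝ) + 2) / ((n : ℝ) + 2 + t))
        ≤ (2 ^ t * ((n : ℝ) + 2) ^ (-t)) * (((n:ℝ) + 2) ^ t / ((n:ℝ) + 3) ^ t) := by
          gcongr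
      _ = 2 ^ t * (((n + 1 : ℕ) : ℝ) + 2) ^ (-t) := by
          rw [Real.rpow_neg (by positivity), Real.rpow_neg (by positivity)]
          push_cast
          rw [show (n:ℝ) + 1 + 2 = n + 3 by ring]
          field_simp

/-- `n! / ∏_{i=0}^n (a + i)` -/
noncomputable def bN (a : ℝ) : ℕ → ℝ
  | 0 => 1 / a
  | n + 1 => bN a n * (((n : ℝ) + 1) / (a + n + 1))

lemma bN_shift {a : ℝ} (ha : 0 < a) (n : ℕ) : bN (a + 1) n = bN a n * (a / (a + n + 1)) := by
  induction n with
  | zero => simp [bN]; field_simp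
  | succ n ih =>
    rw [bN, bN, ih]
    push_cast
    have h1 : a + n + 1 ≠ 0 := by positivity
    have h2 : a + 1 + n + 1 ≠ 0 := by positivity
    have h3 : a + (n + 1) + 1 ≠ 0 := by positivity
    field_simp
    ring

lemma bN_rec {a : ℝ} (ha : 0 < a) (n : ℕ) : bN a (n + 1) = bN a n - bN (a + 1) n := by
  rw [bN_shift ha, bN]
  have h1 : a + n + 1 ≠ 0 := by positivity
  field_simp
  ring

lemma WN_bN {t : ℝ} (ht : -2 < t) (p : ℕ) :
    WN t p / ((p : ℝ) + 2 + t) = ((p : ℝ) + 1) * bN (2 + t) p := by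
  induction p with
  | zero => simp [WN, bN]
  | succ p ih =>
    have h0 : (0:ℝ) ≤ p := by positivity
    have h1 : (p : ℝ) + 2 + t ≠ 0 := by linarith
    have h2 : (p : ℝ) + 1 + 2 + t ≠ 0 := by linarith
    have h3 : 2 + t + p + 1 ≠ 0 := by linarith
    have h4 : WN t p = ((p : ℝ) + 1) * bN (2 + t) p * ((p : ℝ) + 2 + t) := by
      rw [← ih]; field_simp
    rw [WN, bN, h4]
    push_cast
    rw [show 2 + t + (p:ℝ) + 1 = (p : ℝ) + 1 + 2 + t by ring]
    field_simp
    ring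

lemma WN_step {t : ℝ} (ht : -2 < t) (ht0 : t ≠ 0) (p : ℕ) :
    (1 - WN t (p + 1)) / t = (1 - WN t p) / t + ((p : ℝ) + 1) * bN (2 + t) p := by
  rw [← WN_bN ht, WN]
  have h0 : (0:ℝ) ≤ p := by positivity
  have h1 : (p : ℝ) + 2 + t ≠ 0 := by linarith
  field_simp
  ring

lemma HN_pos' {m : ℕ} (hm : 1 ≤ m) : 0 < HN m := HN_pos hm

open Filter Topology in
lemma moments (μ : Measure ℝ)
    (hMellin : ∀ s : ℝ, 1 < s →
      ∫ x in Set.Ioo (0:ℝ) 1, x ^ (s - 1) ∂μ = 1 / (digamma s - digamma 1))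
    (r l : (N : ℕ) → Fin (N + 1) → ℝ)
    (hl : ∀ N j, r N j ≠ 0 → l N j ≤ 1)
    (hs : ∀ N s, 1 < s → ∑ j, r N j / (s - l N j) = 1 / DN (N + 1) s - 1 / HN (N + 1))
    (n : ℕ) : ∀ m : ℕ, 1 ≤ m →
      IntegrableOn (fun x : ℝ => x ^ m * (1 - x) ^ n) (Set.Ioo 0 1) μ ∧
      Tendsto (fun N => ∑ j, r N j * bN ((m : ℝ) + 1 - l N j) n) atTop
        (𝓝 (∫ x in Set.Ioo (0:ℝ) 1, x ^ m * (1 - x) ^ n ∂μ)) := by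
  induction n with
  | zero =>
    intro m hm
    have hm' : (1:ℝ) ≤ m := by exact_mod_cast hm
    have hpos := HN_pos' hm
    have h1 : ∫ x in Set.Ioo (0:ℝ) 1, x ^ m * (1 - x) ^ 0 ∂μ = 1 / HN m := by
      have := hMellin (m + 1) (by linarith)
      rw [digamma_nat] at this
      simpa using this
    refine ⟨?_, ?_⟩
    · by_contra hcon
      rw [integral_undef hcon] at h1
      have : 0 < 1 / HN m := by positivity
      linarith
    · rw [h1]
      have h2 : ∀ N, ∑ j, r N j * bN ((m : ℝ) + 1 - l N j) 0
          = 1 / DN (N + 1) ((m : ℝ) + 1) - 1 / HN (N + 1) := by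
        intro N
        rw [← hs N _ (by linarith)]
        refine Finset.sum_congr rfl fun j _ => ?_
        rw [bN]; ring
      simp only [h2]
      have h3 := (tendsto_const_nhds (x := (1:ℝ))).div (DN_nat_tendsto m) hpos.ne'
      have h4 := (h3.sub HN_tendsto).comp (tendsto_add_atTop_nat 1)
      simpa [Function.comp_def] using h4
  | succ n ih =>
    intro m hm
    have hm' : (1:ℝ) ≤ m := by exact_mod_cast hm
    obtain ⟨i1, t1⟩ := ih m hm
    obtain ⟨i2, t2⟩ := ih (m + 1) (by omega)
    have hfun : (fun x : ℝ => x ^ m * (1 - x) ^ (n + 1))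
        = fun x => x ^ m * (1 - x) ^ n - x ^ (m + 1) * (1 - x) ^ n := by
      funext x; ring
    refine ⟨?_, ?_⟩
    · rw [hfun]; exact i1.sub i2
    · rw [hfun, integral_sub i1 i2]
      refine (t1.sub t2).congr fun N => ?_
      rw [← Finset.sum_sub_distrib]
      refine Finset.sum_congr rfl fun j _ => ?_
      by_cases hr : r N j = 0
      · simp [hr]
      · have := hl N j hr
        rw [bN_rec (by linarith)]
        push_cast
        rw [show (m:ℝ) + 1 + 1 - l N j = m + 1 - l N j + 1 by ring]
        ring

open Filter Topology in
lemma L_tendsto (μ : Measure ℝ)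
    (r l : (N : ℕ) → Fin (N + 1) → ℝ)
    (hl : ∀ N j, r N j ≠ 0 → l N j ≤ 1 ∧ l N j ≠ 0)
    (hI : ∀ n, IntegrableOn (fun x : ℝ => x ^ 1 * (1 - x) ^ n) (Set.Ioo 0 1) μ ∧
      Tendsto (fun N => ∑ j, r N j * bN (((1 : ℕ) : ℝ) + 1 - l N j) n) atTop
        (𝓝 (∫ x in Set.Ioo (0:ℝ) 1, x ^ 1 * (1 - x) ^ n ∂μ)))
    (p : ℕ) :
      IntegrableOn (fun x : ℝ => (1 - (1 - x) ^ (p + 1) - ((p + 1 : ℕ) : ℝ) * x * (1 - x) ^ p) / x)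
        (Set.Ioo 0 1) μ ∧
      Tendsto (fun N => ∑ j, r N j * ((1 - WN (- l N j) p) / (- l N j))) atTop
        (𝓝 (∫ x in Set.Ioo (0:ℝ) 1,
          (1 - (1 - x) ^ (p + 1) - ((p + 1 : ℕ) : ℝ) * x * (1 - x) ^ p) / x ∂μ)) := by
  induction p with
  | zero => simp [WN]
  | succ p ih =>
    obtain ⟨i1, t1⟩ := ih
    obtain ⟨i2, t2⟩ := hI p
    have hfun : Set.EqOn
        (fun x : ℝ => (1 - (1 - x) ^ (p + 1 + 1) -
          ((p + 1 + 1 : ℕ) : ℝ) * x * (1 - x) ^ (p + 1)) / x)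
        (fun x => (1 - (1 - x) ^ (p + 1) - ((p + 1 : ℕ) : ℝ) * x * (1 - x) ^ p) / x
          + ((p : ℝ) + 1) * (x ^ 1 * (1 - x) ^ p)) (Set.Ioo 0 1) := by
      intro x hx
      have : x ≠ 0 := hx.1.ne'
      simp only
      push_cast
      field_simp
      ring
    have i3 := i2.const_mul ((p : ℝ) + 1)
    refine ⟨?_, ?_⟩
    · rw [integrableOn_congr_fun hfun measurableSet_Ioo]
      exact i1.add i3
    · rw [setIntegral_congr_fun measurableSet_Ioo hfun, integral_add i1 i3, integral_const_mul]
      refine (t1.add (t2.const_mul ((p : ℝ) + 1))).congr fun N => ?_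
      rw [Finset.mul_sum, ← Finset.sum_add_distrib]
      refine Finset.sum_congr rfl fun j _ => ?_
      by_cases hr : r N j = 0
      · simp [hr]
      · have := hl N j hr
        rw [WN_step (by linarith) (by simpa using this.2)]
        push_cast
        rw [show (1:ℝ) + 1 - l N j = 2 + - l N j by ring]
        ring

lemma level_bound {N : ℕ} (hN : 0 < N) (r l : Fin N → ℝ) (s : ℝ) (hs0 : s < 0)
    (hr : ∀ j, 0 ≤ r j) (hl : ∀ j, r j ≠ 0 → l j = 1 ∨ l j ≤ s)
    (h0 : ∑ j, r j / l j = 1 / HN N)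
    (h1 : ∑ j, (if l j = 1 then r j else 0) = 1 / ZN N) (p : ℕ) :
    |∑ j, r j * ((1 - WN (- l j) p) / (- l j)) - (1 / ZN N * ((p : ℝ) + 1) - 1 / HN N)|
      ≤ WN (-s) p := by
  have hW := (WN_pos (t := -s) (by linarith) p)
  have e : ∑ j, r j * ((1 - WN (- l j) p) / (- l j)) - (1 / ZN N * ((p : ℝ) + 1) - 1 / HN N)
      = ∑ j, (if l j = 1 then 0 else r j * WN (- l j) p / l j) := by
    rw [← h0, ← h1, Finset.sum_mul, ← Finset.sum_sub_distrib, ← Finset.sum_sub_distrib]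
    refine Finset.sum_congr rfl fun j _ => ?_
    split_ifs with h
    · rw [h, WN_neg_one]; ring
    · rw [div_neg]; ring
  rw [e]
  have hZ := ZN_ge hN
  have hH := HN_pos hN
  calc |∑ j, (if l j = 1 then 0 else r j * WN (- l j) p / l j)|
      ≤ ∑ j, |(if l j = 1 then 0 else r j * WN (- l j) p / l j)| :=
        Finset.abs_sum_le_sum_abs _ _
    _ ≤ ∑ j, WN (-s) p * ((if l j = 1 then r j else 0) - r j / l j) := by
        refine Finset.sum_le_sum fun j _ => ?_
        split_ifs with h
        · simp [h]
        · by_cases hj : r j = 0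
          · simp [hj]
          · have h2 := (hl j hj).resolve_left h
            have h3 := WN_anti (t := -s) (u := - l j) (by linarith) (by linarith) p
            have h4 := WN_pos (t := - l j) (by linarith) p
            have h5 : 0 ≤ r j / (- l j) := div_nonneg (hr j) (by linarith)
            have h6 : r j * WN (- l j) p / l j = - (WN (- l j) p * (r j / (- l j))) := by
              rw [div_neg]; ring
            rw [h6, abs_neg, abs_of_nonneg (by positivity), zero_sub, ← div_neg]
            gcongr
    _ = WN (-s) p * (1 / ZN N - 1 / HN N) := by
        rw [← Finset.mul_sum, Finset.sum_sub_distrib, h0, h1]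
    _ ≤ WN (-s) p * 1 := by
        gcongr
        have : 1 / ZN N ≤ 1 := by rw [div_le_one (by linarith)]; exact hZ
        have : 0 < 1 / HN N := by positivity
        linarith
    _ = WN (-s) p := mul_one _

theorem stmt19 (μ : Measure ℝ) [SigmaFinite μ]
    (hsupp : μ (Set.Ioo (0:ℝ) 1)ᶜ = 0)
    (hMellin : ∀ s : ℝ, 1 < s →
      ∫ x in Set.Ioo (0:ℝ) 1, x ^ (s - 1) ∂μ = 1 / (digamma s - digamma 1))
    (s₁ : ℝ) (hs₁ : s₁ ∈ Set.Ioo (-1:ℝ) 0) (hroot : digamma s₁ = digamma 1) :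
    ∃ C : ℝ, ∀ n : ℕ, 2 ≤ n →
      |(∫ x in Set.Ioo (0:ℝ) 1,
          (1 - (1 - x) ^ n - (n : ℝ) * x * (1 - x) ^ (n - 1)) / x ∂μ)
        - (6 / Real.pi ^ 2) * n|
        ≤ C * (n : ℝ) ^ (-|s₁|) := by
  choose r l hr hD h0 hs h1 using fun N : ℕ => spectral (N + 1) N.succ_pos
  have hl : ∀ N j, r N j ≠ 0 → l N j = 1 ∨ l N j ≤ s₁ := by
    intro N j hj
    obtain ⟨hd, hk⟩ := hD N j hj
    have hne : l N j ≠ 0 := by simpa using hk 0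
    rcases lt_or_gt_of_ne hne with h | h
    · right
      by_contra hcon
      push Not at hcon
      have h2 := DN_lt N.succ_pos hs₁.1 hcon h
      have h3 := DN_root_nonneg hs₁ hroot (N + 1) N.succ_pos
      linarith
    · left
      exact DN_root N.succ_pos h hd
  have hl1 : ∀ N j, r N j ≠ 0 → l N j ≤ 1 ∧ l N j ≠ 0 := by
    intro N j hj
    rcases hl N j hj with h | h
    · rw [h]; norm_num
    · have := hs₁.2
      exact ⟨by linarith, by linarith⟩
  refine ⟨2 ^ (-s₁), fun n hn => ?_⟩
  obtain ⟨p, rfl⟩ : ∃ p, n = p + 1 := ⟨n - 1, by omega⟩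
  obtain ⟨-, ht⟩ := L_tendsto μ r l hl1
    (fun n => moments μ hMellin r l (fun N j hj => (hl1 N j hj).1) hs n 1 le_rfl) p
  rw [Nat.add_sub_cancel, abs_of_neg hs₁.2, neg_neg]
  have hZ := ZN_tendsto.comp (Filter.tendsto_add_atTop_nat 1)
  have hH := HN_tendsto.comp (Filter.tendsto_add_atTop_nat 1)
  have hlim := (ht.sub ((hZ.mul_const ((p : ℝ) + 1)).sub hH)).abs
  have hb := le_of_tendsto hlim (Filter.Eventually.of_forall fun N =>
    level_bound N.succ_pos (r N) (l N) s₁ hs₁.2 (hr N) (hl N) (h0 N) (h1 N) p)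
  rw [sub_zero] at hb
  have hb2 := WN_bound (t := -s₁) (by linarith [hs₁.2]) (by linarith [hs₁.1]) p
  have hb3 : ((p : ℝ) + 2) ^ (- -s₁) ≤ (((p + 1 : ℕ) : ℝ)) ^ s₁ := by
    rw [neg_neg]
    refine Real.rpow_le_rpow_of_nonpos (by positivity) (by push_cast; linarith) hs₁.2.le
  have e : ((p + 1 : ℕ) : ℝ) = (p : ℝ) + 1 := by push_cast; ring
  calc _ ≤ WN (-s₁) p := by rw [e] at hb ⊢; exact hb
    _ ≤ _ := hb2
    _ ≤ _ := by gcongr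
end
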